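/- Let p be an odd prime, set F = ℤ/pℤ, R = F[w, x, y, z]/(w^4 + x^4 + y^4 + z^4), and I = (w, x, y, z). Then the Hilbert–Kunz multiplicity e_HK(I, R) = lim_{n→∞} dim_F(R/I^{[p^n]})/p^{3n} exists and equals (8/3)·(2p² + 2p + 3)/(2p² + 2p + 1) if p ≡ 1 (mod 4), and (8/3)·(2p² − 2p + 3)/(2p² − 2p + 1) if p ≡ 3 (mod 4). In particular e_HK(I, R) = 8/3 + O(1/p²) as p → ∞. -/

import Mathlib

open MvPolynomial Filter

/-- `Dcolength F s k` : dimension over `F` of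
`F[y_1,…,y_s] / (y_1^{k_1}, …, y_s^{k_s}, (y_1+⋯+y_s)^{k_{s+1}})`,
i.e. the quantity `D_F(k_1, …, k_{s+1})` of Han–Monsky (with `s+1` arguments
and `s` variables). -/
noncomputable def Dcolength (F : Type) [CommRing F] (s : ℕ) (k : Fin (s+1) → ℕ) : ℕ :=
  Module.finrank F (MvPolynomial (Fin s) F ⧸
    Ideal.span (Set.range (fun i : Fin s =>
        (X i : MvPolynomial (Fin s) F) ^ k i.castSucc) ∪
      {(∑ i : Fin s, (X i : MvPolynomial (Fin s) F)) ^ k (Fin.last s)}))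

/-- Dimension over `F` of `R/𝔪^{[q]}` where
`R = F[x_1,…,x_s]/(x_1^{d_1}+⋯+x_s^{d_s})` and `𝔪^{[q]} = (x_1^q,…,x_s^q)`. -/
noncomputable def hkColength (F : Type) [CommRing F] (s : ℕ) (d : Fin s → ℕ) (q : ℕ) : ℕ :=
  Module.finrank F (MvPolynomial (Fin s) F ⧸
    Ideal.span (insert (∑ i : Fin s, (X i : MvPolynomial (Fin s) F) ^ d i)
      (Set.range fun i : Fin s => (X i : MvPolynomial (Fin s) F) ^ q)))

/-- The Han–Monsky function `g_λ(x_1,…,x_s)`. -/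
noncomputable def gl (s : ℕ) (x : Fin s → ℝ) (lam : ℤ) : ℝ :=
  ∑ ε ∈ Finset.univ.filter
      (fun ε : Fin s → Bool =>
        2 * (lam : ℝ) ≤ ∑ i, (if ε i then (1:ℝ) else -1) * x i),
    (∏ i, (if ε i then (1:ℝ) else -1)) *
      ((∑ i, (if ε i then (1:ℝ) else -1) * x i) - 2 * (lam : ℝ)) ^ (s - 1)

/-- The Han–Monsky function `g(x_1,…,x_s) = (1/(2^{s-1}(s-1)!)) Σ_λ g_λ(x)`. -/
noncomputable def gfun (s : ℕ) (x : Fin s → ℝ) : ℝ :=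
  (1 / (2 ^ (s-1) * (Nat.factorial (s-1)))) * ∑' lam : ℤ, gl s x lam



namespace HKaux

section basics
variable {F : Type} [Field F]

/-- The three linear forms with sum zero. -/
noncomputable def lf (F : Type) [Field F] : Fin 3 → MvPolynomial (Fin 2) F :=
  ![X 0, X 1, -(X 0 + X 1)]

lemma lf_zero : lf F 0 = X 0 := rfl
lemma lf_one : lf F 1 = X 1 := rfl
lemma lf_two : lf F 2 = -(X 0 + X 1) := rfl

lemma lf_hom (i : Fin 3) : (lf F i).IsHomogeneous 1 := by
  fin_cases i
  · exact isHomogeneous_X _ _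
  · exact isHomogeneous_X _ _
  · exact ((isHomogeneous_X _ _).add (isHomogeneous_X _ _)).neg

lemma lf_ne_zero (i : Fin 3) : lf F i ≠ 0 := by
  intro h
  have h0 := congrArg (eval ![(1 : F), 0]) h
  have h1 := congrArg (eval ![(0 : F), 1]) h
  fin_cases i <;> simp [lf] at h0 h1

lemma lf_prime (i : Fin 3) : Prime (lf F i) := by
  rw [← UniqueFactorizationMonoid.irreducible_iff_prime]
  apply irreducible_of_totalDegree_eq_one
  · exact (lf_hom i).totalDegree (lf_ne_zero i)
  · intro x hx
    rw [isUnit_iff_ne_zero]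
    rintro rfl
    apply lf_ne_zero (F := F) i
    ext m
    simpa using hx m

lemma lf_not_dvd {i j : Fin 3} (hij : i ≠ j) : ¬ lf F i ∣ lf F j := by
  rintro ⟨c, hc⟩
  have h0 := congrArg (eval ![(0 : F), 1]) hc
  have h1 := congrArg (eval ![(1 : F), 0]) hc
  have h2 := congrArg (eval ![(1 : F), -1]) hc
  fin_cases i <;> fin_cases j <;> simp [lf] at h0 h1 h2 hij

lemma lf_relprime {i j : Fin 3} (hij : i ≠ j) : IsRelPrime (lf F i) (lf F j) :=
  ((lf_prime i).irreducible.isRelPrime_iff_not_dvd).2 (lf_not_dvd hij)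

lemma lf_pow_relprime {i j : Fin 3} (hij : i ≠ j) (a b : ℕ) :
    IsRelPrime (lf F i ^ a) (lf F j ^ b) := (lf_relprime hij).pow

/-- Product of powers of the three forms. -/
noncomputable def PP (F : Type) [Field F] (n : Fin 3 → ℕ) : MvPolynomial (Fin 2) F :=
  ∏ i, lf F i ^ n i

lemma PP_ne_zero (n : Fin 3 → ℕ) : PP F n ≠ 0 :=
  Finset.prod_ne_zero_iff.2 fun i _ => pow_ne_zero _ (lf_ne_zero i)

lemma PP_hom (n : Fin 3 → ℕ) : (PP F n).IsHomogeneous (∑ i, n i) := by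
  apply IsHomogeneous.prod
  intro i _
  simpa using (lf_hom (F := F) i).pow (n i)

lemma PP_dvd {n : Fin 3 → ℕ} {f : MvPolynomial (Fin 2) F} (h : ∀ i, lf F i ^ n i ∣ f) :
    PP F n ∣ f := by
  apply Fintype.prod_dvd_of_isRelPrime _ h
  intro i j hij
  exact lf_pow_relprime hij _ _

lemma hom_quot {f g : MvPolynomial (Fin 2) F} {e n : ℕ} (hg0 : g ≠ 0) (hg : g.IsHomogeneous e)
    (h : (g * f).IsHomogeneous (e + n)) : f.IsHomogeneous n := by
  let _ := MvPolynomial.gradedAlgebra (σ := Fin 2) (R := F)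
  have h1 := DirectSum.coe_decompose_mul_add_of_left_mem (homogeneousSubmodule (Fin 2) F)
    (i := e) (j := n) (a := g) (b := f) hg
  have h2 := DirectSum.decompose_of_mem_same (homogeneousSubmodule (Fin 2) F) (i := e + n) h
  rw [h2] at h1
  have h3 := mul_left_cancel₀ hg0 h1
  rw [h3]
  exact (DirectSum.decompose (homogeneousSubmodule (Fin 2) F) f n).2

lemma hom_dvd_le {f g : MvPolynomial (Fin 2) F} {e n : ℕ} (hg : g.IsHomogeneous e)
    (hf : f.IsHomogeneous n) (hf0 : f ≠ 0) (h : g ∣ f) : e ≤ n := by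
  obtain ⟨c, rfl⟩ := h
  have hg0 : g ≠ 0 := left_ne_zero_of_mul hf0
  have hc0 : c ≠ 0 := right_ne_zero_of_mul hf0
  rw [← hf.totalDegree hf0, totalDegree_mul_of_isDomain hg0 hc0, hg.totalDegree hg0]
  omega

/-- homogeneous quotient -/
lemma hom_dvd {f g : MvPolynomial (Fin 2) F} {e n : ℕ} (hg0 : g ≠ 0) (hg : g.IsHomogeneous e)
    (hf : f.IsHomogeneous n) (h : g ∣ f) :
    ∃ c, f = g * c ∧ c.IsHomogeneous (n - e) ∧ (f ≠ 0 → e ≤ n) := by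
  by_cases hf0 : f = 0
  · exact ⟨0, by simp [hf0], isHomogeneous_zero _ _ _, fun h => (h hf0).elim⟩
  have hle := hom_dvd_le hg hf hf0 h
  obtain ⟨c, rfl⟩ := h
  refine ⟨c, rfl, hom_quot hg0 hg ?_, fun _ => hle⟩
  rwa [Nat.add_sub_cancel' hle]

lemma hom_zero_C {f : MvPolynomial (Fin 2) F} (h : f.IsHomogeneous 0) : ∃ c, f = C c := by
  have := (totalDegree_zero_iff_isHomogeneous (Fin 2)).2 h
  exact ⟨_, totalDegree_eq_zero_iff_eq_C.1 this⟩

/-- reduction modulo a form -/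
lemma red_mod (i : Fin 3) {f : MvPolynomial (Fin 2) F} {d : ℕ} (hf : f.IsHomogeneous d) :
    ∃ c : F, lf F i ∣ f - C c * lf F (i + 1) ^ d := by
  have hc : ∃ c : Fin 2 → F, ∀ j, lf F i ∣ X j - C (c j) * lf F (i + 1) := by
    fin_cases i
    · refine ⟨![0, 1], fun j => ?_⟩
      fin_cases j <;> simp [lf]
    · refine ⟨![-1, 0], fun j => ?_⟩
      fin_cases j
      · refine ⟨-1, ?_⟩
        simp [lf]
      · simp [lf]
    · refine ⟨![1, -1], fun j => ?_⟩
      fin_cases j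
      · simp [lf]
      · refine ⟨-1, ?_⟩
        simp [lf]
        ring
  obtain ⟨c, hc⟩ := hc
  refine ⟨∑ m ∈ f.support, coeff m f * ∏ j, c j ^ m j, ?_⟩
  have h1 : f = ∑ m ∈ f.support, C (coeff m f) * ∏ j, X j ^ m j := by
    conv_lhs => rw [f.as_sum]
    refine Finset.sum_congr rfl fun m _ => ?_
    rw [monomial_eq, Finsupp.prod_fintype]
    simp
  have h2 : C (∑ m ∈ f.support, coeff m f * ∏ j, c j ^ m j) * lf F (i + 1) ^ d
      = ∑ m ∈ f.support, C (coeff m f) * ∏ j, (C (c j) * lf F (i + 1)) ^ m j := by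
    rw [map_sum, Finset.sum_mul]
    refine Finset.sum_congr rfl fun m hm => ?_
    have hd : d = m 0 + m 1 := by
      rw [hf.degree_eq_sum_deg_support hm, ← Fin.sum_univ_two]
      exact Finset.sum_subset (Finset.subset_univ _) (by simp)
    rw [hd]
    simp only [mul_pow, Fin.prod_univ_two, pow_add, map_mul, map_pow]
    ring
  rw [h2]
  conv => rhs; lhs; rw [h1]
  rw [← Finset.sum_sub_distrib]
  refine Finset.dvd_sum fun m _ => ?_
  rw [← mul_sub]
  refine Dvd.dvd.mul_left ?_ _
  rw [← Ideal.mem_span_singleton, ← Ideal.Quotient.eq, map_prod, map_prod]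
  refine Finset.prod_congr rfl fun j _ => ?_
  rw [map_pow, map_pow]
  congr 1
  rw [Ideal.Quotient.eq, Ideal.mem_span_singleton]
  exact hc j

end basics
end HKaux


namespace HKaux

section syz
variable {F : Type} [Field F]

/-- Scaled syzygy vectors: homogeneous of degree `d`, sum zero, all entries divisible by
`ℓ_i ^ n_i`, and the `i`-th entry divisible by `ℓ_i ^ (n_i + k_i)`. -/
structure Sc (n k : Fin 3 → ℕ) (d : ℕ) (g : Fin 3 → MvPolynomial (Fin 2) F) : Prop where
  sum : g 0 + g 1 + g 2 = 0
  hom : ∀ c, (g c).IsHomogeneous d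
  all : ∀ i c, lf F i ^ n i ∣ g c
  own : ∀ i, lf F i ^ (n i + k i) ∣ g i

/-- determinant of two vectors -/
noncomputable def dt (g h : Fin 3 → MvPolynomial (Fin 2) F) : MvPolynomial (Fin 2) F :=
  g 0 * h 1 - g 1 * h 0

lemma dt_cyc {g h : Fin 3 → MvPolynomial (Fin 2) F} (hg : g 0 + g 1 + g 2 = 0)
    (hh : h 0 + h 1 + h 2 = 0) (i : Fin 3) : dt g h = g i * h (i + 1) - g (i + 1) * h i := by
  have e1 : g 2 = - g 0 - g 1 := by linear_combination hg
  have e2 : h 2 = - h 0 - h 1 := by linear_combination hh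
  fin_cases i
  · simp [dt]
  · simp only [dt, Fin.mk_one, Fin.isValue, Fin.reduceAdd]
    rw [e1, e2]; ring
  · simp only [dt, Fin.reduceFinMk, Fin.isValue, Fin.reduceAdd]
    rw [e1, e2]; ring

lemma cramer {A B D : Fin 3 → MvPolynomial (Fin 2) F} (hA : A 0 + A 1 + A 2 = 0)
    (hB : B 0 + B 1 + B 2 = 0) (hD : D 0 + D 1 + D 2 = 0) (c : Fin 3) :
    dt A B * D c + dt B D * A c + dt D A * B c = 0 := by
  have e1 : A 2 = - A 0 - A 1 := by linear_combination hA
  have e2 : B 2 = - B 0 - B 1 := by linear_combination hB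
  have e3 : D 2 = - D 0 - D 1 := by linear_combination hD
  fin_cases c
  · simp only [dt, Fin.zero_eta]; ring
  · simp only [dt, Fin.mk_one]; ring
  · simp only [dt, Fin.reduceFinMk]; rw [e1, e2, e3]; ring

lemma dt_hom {n k n' k' : Fin 3 → ℕ} {d e : ℕ} {g h : Fin 3 → MvPolynomial (Fin 2) F}
    (hg : Sc n k d g) (hh : Sc n' k' e h) : (dt g h).IsHomogeneous (d + e) :=
  ((hg.hom 0).mul (hh.hom 1)).sub ((hg.hom 1).mul (hh.hom 0))

lemma dt_dvd {k : Fin 3 → ℕ} {d e : ℕ} {g h : Fin 3 → MvPolynomial (Fin 2) F}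
    (hg : Sc 0 k d g) (hh : Sc 0 k e h) : PP F k ∣ dt g h := by
  apply PP_dvd
  intro i
  rw [dt_cyc hg.sum hh.sum i]
  have h1 := hg.own i
  have h2 := hh.own i
  simp only [Pi.zero_apply, zero_add] at h1 h2
  exact dvd_sub (h1.mul_right _) (h2.mul_left _)

lemma dt_zero_of_lt {k : Fin 3 → ℕ} {d e : ℕ} {g h : Fin 3 → MvPolynomial (Fin 2) F}
    (hg : Sc 0 k d g) (hh : Sc 0 k e h) (hlt : d + e < ∑ i, k i) : dt g h = 0 := by
  by_contra h0
  have := hom_dvd_le (PP_hom k) (dt_hom hg hh) h0 (dt_dvd hg hh)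
  omega

lemma dt_const {k : Fin 3 → ℕ} {d e : ℕ} {g h : Fin 3 → MvPolynomial (Fin 2) F}
    (hg : Sc 0 k d g) (hh : Sc 0 k e h) (heq : d + e = ∑ i, k i) :
    ∃ c : F, dt g h = C c * PP F k := by
  obtain ⟨c, hc, hh, _⟩ := hom_dvd (PP_ne_zero k) (PP_hom k) (dt_hom hg hh) (dt_dvd hg hh)
  rw [heq, Nat.sub_self] at hh
  obtain ⟨a, rfl⟩ := hom_zero_C hh
  exact ⟨a, by rw [hc, mul_comm]⟩

/-- A basis of the syzygy module -/
structure Bs (k : Fin 3 → ℕ) (α β : ℕ) (A B : Fin 3 → MvPolynomial (Fin 2) F) : Prop where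
  memA : Sc 0 k α A
  memB : Sc 0 k β B
  det : dt A B ≠ 0
  deg : α + β = ∑ i, k i

lemma dt_swap (A B : Fin 3 → MvPolynomial (Fin 2) F) : dt B A = - dt A B := by
  simp only [dt]; ring

lemma Bs.swap {k : Fin 3 → ℕ} {α β : ℕ} {A B : Fin 3 → MvPolynomial (Fin 2) F}
    (h : Bs k α β A B) : Bs k β α B A :=
  ⟨h.memB, h.memA, by rw [dt_swap]; exact neg_ne_zero.2 h.det, by rw [add_comm]; exact h.deg⟩

lemma Bs.eq_zero {k : Fin 3 → ℕ} {α β : ℕ} {A B D : Fin 3 → MvPolynomial (Fin 2) F}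
    (h : Bs k α β A B) (hD : D 0 + D 1 + D 2 = 0) (h1 : dt D A = 0) (h2 : dt D B = 0) : D = 0 := by
  funext c
  have := cramer h.memA.sum h.memB.sum hD c
  rw [h1, dt_swap D B, h2] at this
  simpa [h.det] using this

lemma Bs.min {k : Fin 3 → ℕ} {α β d : ℕ} {A B D : Fin 3 → MvPolynomial (Fin 2) F}
    (h : Bs k α β A B) (hab : α ≤ β) (hD : Sc 0 k d D) (h0 : D ≠ 0) : α ≤ d := by
  by_contra hlt
  push Not at hlt
  have := h.deg
  exact h0 (h.eq_zero hD.sum (dt_zero_of_lt hD h.memA (by omega))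
    (dt_zero_of_lt hD h.memB (by omega)))

lemma Bs.ne_zero {k : Fin 3 → ℕ} {α β : ℕ} {A B : Fin 3 → MvPolynomial (Fin 2) F}
    (h : Bs k α β A B) : A ≠ 0 := by
  rintro rfl
  apply h.det
  simp [dt]

/-- `k` has syzygy gap `δ` -/
def HasGap (F : Type) [Field F] (k : Fin 3 → ℕ) (δ : ℕ) : Prop :=
  ∃ (α : ℕ) (A B : Fin 3 → MvPolynomial (Fin 2) F), Bs k α (α + δ) A B

lemma HasGap.unique {k : Fin 3 → ℕ} {δ δ' : ℕ} (h : HasGap F k δ) (h' : HasGap F k δ') :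
    δ = δ' := by
  obtain ⟨α, A, B, h⟩ := h
  obtain ⟨α', A', B', h'⟩ := h'
  have h1 := h.min (by omega) h'.memA h'.ne_zero
  have h2 := h'.min (by omega) h.memA h.ne_zero
  have := h.deg
  have := h'.deg
  omega

lemma Bs.step_aux {k : Fin 3 → ℕ} {α β : ℕ} {A B : Fin 3 → MvPolynomial (Fin 2) F}
    (h : Bs k α β A B) (hab : α ≤ β) (i : Fin 3) :
    (∃ c : F, c ≠ 0 ∧ k i ≤ α ∧
      (∃ a, A i = lf F i ^ k i * (C c * lf F (i + 1) ^ (α - k i) + lf F i * a)) ∧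
      ∃ A' B', Bs (F := F) (k + Pi.single i 1) (α + 1) β A' B') ∨
    (∃ c : F, c ≠ 0 ∧ k i ≤ β ∧
      (∃ b, B i = lf F i ^ k i * (C c * lf F (i + 1) ^ (β - k i) + lf F i * b)) ∧
      ∃ A' B', Bs (F := F) (k + Pi.single i 1) α (β + 1) A' B') := by
  have key : ∀ (d : ℕ) (g : Fin 3 → MvPolynomial (Fin 2) F), Sc 0 k d g →
      ∃ (c : F) (a : _), g i = lf F i ^ k i * (C c * lf F (i + 1) ^ (d - k i) + lf F i * a) ∧
        (c ≠ 0 → k i ≤ d) := by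
    intro d g hg
    have hp : (lf F i ^ k i).IsHomogeneous (k i) := by simpa using (lf_hom (F := F) i).pow (k i)
    have hown := hg.own i
    simp only [Pi.zero_apply, zero_add] at hown
    by_cases hg0 : g i = 0
    · exact ⟨0, 0, by simp [hg0], fun h => (h rfl).elim⟩
    obtain ⟨q, hq, hqh, hle⟩ := hom_dvd (pow_ne_zero _ (lf_ne_zero i)) hp (hg.hom i) hown
    obtain ⟨c, a, ha⟩ := red_mod i hqh
    exact ⟨c, a, by rw [hq, ← ha]; ring, fun _ => hle hg0⟩
  have hsum : ∑ j, (k + Pi.single i 1 : Fin 3 → ℕ) j = ∑ j, k j + 1 := by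
    simp [Finset.sum_add_distrib]
  -- raising
  have raise : ∀ (d : ℕ) (g : Fin 3 → MvPolynomial (Fin 2) F), Sc 0 k d g →
      lf F i ^ (k i + 1) ∣ g i → Sc 0 (k + Pi.single i 1) d g := by
    intro d g hg hd
    refine ⟨hg.sum, hg.hom, hg.all, fun j => ?_⟩
    by_cases hj : j = i
    · subst hj; simpa using hd
    · simpa [hj] using hg.own j
  have scale : ∀ (d : ℕ) (g : Fin 3 → MvPolynomial (Fin 2) F), Sc 0 k d g →
      Sc 0 (k + Pi.single i 1) (d + 1) (fun c => lf F i * g c) := by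
    intro d g hg
    refine ⟨by linear_combination lf F i * hg.sum, fun c => ?_, by simp, fun j => ?_⟩
    · rw [add_comm]; exact (lf_hom i).mul (hg.hom c)
    · have := hg.own j
      by_cases hj : j = i
      · subst hj
        simp only [Pi.zero_apply, zero_add, Pi.add_apply, Pi.single_eq_same, pow_succ'] at this ⊢
        exact mul_dvd_mul_left _ this
      · simp only [Pi.zero_apply, zero_add, Pi.add_apply, ne_eq, hj, not_false_eq_true,
          Pi.single_eq_of_ne, add_zero] at this ⊢
        exact this.mul_left _
  obtain ⟨a0, a, hA, hleA⟩ := key α A h.memA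
  obtain ⟨b0, b, hB, hleB⟩ := key β B h.memB
  by_cases ha0 : a0 = 0
  · right
    have hA' : Sc 0 (k + Pi.single i 1) α A := by
      apply raise _ _ h.memA
      rw [hA, ha0]
      exact ⟨a, by simp; ring⟩
    by_cases hb0 : b0 = 0
    · exfalso
      have hB' : Sc 0 (k + Pi.single i 1) β B := by
        apply raise _ _ h.memB
        rw [hB, hb0]
        exact ⟨b, by simp; ring⟩
      apply h.det
      apply dt_zero_of_lt hA' hB'
      rw [hsum, h.deg]; omega
    refine ⟨b0, hb0, hleB hb0, ⟨b, hB⟩, A, fun c => lf F i * B c, hA', scale _ _ h.memB, ?_, ?_⟩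
    · have : dt A (fun c => lf F i * B c) = lf F i * dt A B := by simp only [dt]; ring
      rw [this]
      exact mul_ne_zero (lf_ne_zero i) h.det
    · rw [hsum, ← h.deg]; ring
  · left
    have hkα := hleA ha0
    set m := C (b0 / a0) * lf F (i + 1) ^ (β - α) with hm
    have hmh : m.IsHomogeneous (β - α) := by
      simpa using IsHomogeneous.C_mul ((lf_hom (F := F) (i + 1)).pow (β - α)) (b0 / a0)
    refine ⟨a0, ha0, hkα, ⟨a, hA⟩, fun c => lf F i * A c, fun c => B c - m * A c,
      scale _ _ h.memA, ?_, ?_, ?_⟩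
    · apply raise
      · refine ⟨?_, fun c => ?_, by simp, fun j => ?_⟩
        · linear_combination h.memB.sum - m * h.memA.sum
        · refine (h.memB.hom c).sub ?_
          have := hmh.mul (h.memA.hom c)
          rwa [Nat.sub_add_cancel hab] at this
        · exact dvd_sub (h.memB.own j) ((h.memA.own j).mul_left _)
      · refine ⟨b - m * a, ?_⟩
        have e1 : C b0 = C (b0 / a0) * (C a0 : MvPolynomial (Fin 2) F) := by
          rw [← C_mul, div_mul_cancel₀ _ ha0]
        have e2 : lf F (i + 1) ^ (β - k i) = lf F (i + 1) ^ (β - α) * lf F (i + 1) ^ (α - k i) := by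
          rw [← pow_add]; congr 1; omega
        rw [hA, hB, hm, e1, e2]
        ring
    · have : dt (fun c => lf F i * A c) (fun c => B c - m * A c) = lf F i * dt A B := by
        simp only [dt]; ring
      rw [this]
      exact mul_ne_zero (lf_ne_zero i) h.det
    · rw [hsum, ← h.deg]; ring

lemma hasGap_of_Bs {k : Fin 3 → ℕ} {α β : ℕ} {A B : Fin 3 → MvPolynomial (Fin 2) F}
    (h : Bs k α β A B) (δ : ℕ) (hδ : β = α + δ ∨ α = β + δ) : HasGap F k δ := by
  rcases hδ with rfl | rfl
  · exact ⟨_, _, _, h⟩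
  · exact ⟨_, _, _, h.swap⟩

lemma HasGap.step {k : Fin 3 → ℕ} {δ : ℕ} (h : HasGap F k δ) (i : Fin 3) :
    ∃ δ', HasGap F (k + Pi.single i 1) δ' ∧ ∃ (d : ℕ) (g : Fin 3 → MvPolynomial (Fin 2) F) (c : F)
      (a : _), Sc 0 k d g ∧ c ≠ 0 ∧ k i ≤ d ∧
        g i = lf F i ^ k i * (C c * lf F (i + 1) ^ (d - k i) + lf F i * a) ∧
        ((δ' = δ + 1 ∧ 2 * d = ∑ j, k j + δ) ∨ (δ' + 1 = δ ∧ 2 * d + δ = ∑ j, k j)) := by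
  obtain ⟨α, A, B, h⟩ := h
  have hdeg := h.deg
  rcases h.step_aux (by omega) i with ⟨c, hc, hk, ⟨a, ha⟩, A', B', h'⟩ | ⟨c, hc, hk, ⟨a, ha⟩, A', B', h'⟩
  · rcases Nat.eq_zero_or_pos δ with h0 | h0
    · refine ⟨δ + 1, hasGap_of_Bs h' _ (by omega), α, A, c, a, h.memA, hc, hk, ha, ?_⟩
      left; omega
    · refine ⟨δ - 1, hasGap_of_Bs h' _ (by omega), α, A, c, a, h.memA, hc, hk, ha, ?_⟩
      right; omega
  · refine ⟨δ + 1, hasGap_of_Bs h' _ (by omega), α + δ, B, c, a, h.memB, hc, hk, ha, ?_⟩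
    left; omega

lemma exists_gap (k : Fin 3 → ℕ) : ∃ δ, HasGap F k δ := by
  induction hs : ∑ i, k i generalizing k with
  | zero =>
    have hk : k = 0 := by
      funext i
      simpa using (Finset.sum_eq_zero_iff.1 hs) i (Finset.mem_univ i)
    subst hk
    refine ⟨0, 0, ![1, 0, -1], ![0, 1, -1], ⟨by simp, ?_, by simp, by simp⟩,
      ⟨by simp, ?_, by simp, by simp⟩, by simp [dt], by simp⟩
    · intro c; fin_cases c
      · exact isHomogeneous_one _ _
      · exact isHomogeneous_zero _ _ _
      · exact (isHomogeneous_one _ _).neg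
    · intro c; fin_cases c
      · exact isHomogeneous_zero _ _ _
      · exact isHomogeneous_one _ _
      · exact (isHomogeneous_one _ _).neg
  | succ n ih =>
    obtain ⟨i, hi⟩ : ∃ i, 0 < k i := by
      by_contra hcon
      push Not at hcon
      have : ∑ i, k i = 0 := Finset.sum_eq_zero fun i _ => by have := hcon i; omega
      omega
    set k' : Fin 3 → ℕ := k - Pi.single i 1 with hk'
    have hkk : k = k' + Pi.single i 1 := by
      funext j
      by_cases hj : j = i
      · subst hj; simp [hk']; omega
      · simp [hk', hj]
    have hs' : ∑ i, k' i = n := by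
      rw [hkk] at hs
      simp [Finset.sum_add_distrib] at hs
      exact hs
    obtain ⟨δ, hδ⟩ := ih k' hs'
    obtain ⟨δ', h', _⟩ := hδ.step i
    rw [hkk]
    exact ⟨δ', h'⟩

noncomputable def gap (F : Type) [Field F] (k : Fin 3 → ℕ) : ℕ := (exists_gap (F := F) k).choose

lemma gap_spec (k : Fin 3 → ℕ) : HasGap F k (gap F k) := (exists_gap (F := F) k).choose_spec

lemma HasGap.eq {k : Fin 3 → ℕ} {δ : ℕ} (h : HasGap F k δ) : gap F k = δ := (gap_spec k).unique h

lemma gap_step (k : Fin 3 → ℕ) (i : Fin 3) :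
    ∃ (d : ℕ) (g : Fin 3 → MvPolynomial (Fin 2) F) (c : F)
      (a : _), Sc 0 k d g ∧ c ≠ 0 ∧ k i ≤ d ∧
        g i = lf F i ^ k i * (C c * lf F (i + 1) ^ (d - k i) + lf F i * a) ∧
        ((gap F (k + Pi.single i 1) = gap F k + 1 ∧ 2 * d = ∑ j, k j + gap F k) ∨
          (gap F (k + Pi.single i 1) + 1 = gap F k ∧ 2 * d + gap F k = ∑ j, k j)) := by
  obtain ⟨δ', h', h2⟩ := (gap_spec (F := F) k).step i
  rw [h'.eq]
  exact h2

lemma gap_lip (k : Fin 3 → ℕ) (i : Fin 3) : gap F (k + Pi.single i 1) = gap F k + 1 ∨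
    gap F (k + Pi.single i 1) + 1 = gap F k := by
  obtain ⟨d, g, c, a, _, _, _, _, h | h⟩ := gap_step (F := F) k i
  · exact Or.inl h.1
  · exact Or.inr h.1

lemma gap_parity (k : Fin 3 → ℕ) : ∃ α, 2 * α + gap F k = ∑ i, k i := by
  obtain ⟨α, A, B, h⟩ := gap_spec (F := F) k
  exact ⟨α, by rw [← h.deg]; ring⟩

/-- every vector has degree at least the minimal one -/
lemma gap_min {k : Fin 3 → ℕ} {d : ℕ} {g : Fin 3 → MvPolynomial (Fin 2) F} (hg : Sc 0 k d g)
    (h0 : g ≠ 0) : ∑ i, k i ≤ 2 * d + gap F k := by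
  obtain ⟨α, A, B, h⟩ := gap_spec (F := F) k
  have := h.min (by omega) hg h0
  rw [← h.deg]; omega

lemma gap_vec (k : Fin 3 → ℕ) : ∃ (d : ℕ) (g : Fin 3 → MvPolynomial (Fin 2) F), Sc 0 k d g ∧ g ≠ 0 ∧
    2 * d + gap F k = ∑ i, k i := by
  obtain ⟨α, A, B, h⟩ := gap_spec (F := F) k
  exact ⟨α, A, h.memA, h.ne_zero, by rw [← h.deg]; ring⟩

end syz
end HKaux


namespace HKaux

section comp
variable {F : Type} [Field F]

lemma descale {n k : Fin 3 → ℕ} {d : ℕ} {g : Fin 3 → MvPolynomial (Fin 2) F} (hg : Sc n k d g)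
    (h0 : g ≠ 0) : ∃ g', Sc 0 k (d - ∑ i, n i) g' ∧ (∀ c, g c = PP F n * g' c) ∧ ∑ i, n i ≤ d := by
  have h1 : ∀ c, ∃ c', g c = PP F n * c' ∧ c'.IsHomogeneous (d - ∑ i, n i) ∧
      (g c ≠ 0 → ∑ i, n i ≤ d) := fun c =>
    hom_dvd (PP_ne_zero n) (PP_hom n) (hg.hom c) (PP_dvd fun i => hg.all i c)
  choose g' hg' hh hle using h1
  refine ⟨g', ⟨?_, hh, by simp, fun i => ?_⟩, hg', ?_⟩
  · have := hg.sum
    rw [hg', hg', hg'] at this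
    apply mul_left_cancel₀ (PP_ne_zero (F := F) n)
    linear_combination this
  · have := hg.own i
    rw [hg', PP, ← Finset.mul_prod_erase _ _ (Finset.mem_univ i), pow_add, mul_assoc] at this
    have h2 := (mul_dvd_mul_iff_left (pow_ne_zero _ (lf_ne_zero i))).1 this
    have h3 : IsRelPrime (lf F i ^ k i) (∏ x ∈ Finset.univ.erase i, lf F x ^ n x) := by
      apply IsRelPrime.prod_right
      intro j hj
      exact lf_pow_relprime (Finset.ne_of_mem_erase hj).symm _ _
    simpa using h3.dvd_of_dvd_mul_left h2
  · by_contra hcon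
    apply h0
    funext c
    by_contra hc
    exact hcon (hle c hc)

/-- scaling exponents -/
def nn (s : Fin 3 → Bool) (r : Fin 3 → ℕ) : Fin 3 → ℕ := fun i => if s i then 0 else r i
/-- shifted exponents -/
def kk (s : Fin 3 → Bool) (u r : Fin 3 → ℕ) : Fin 3 → ℕ :=
  fun i => if s i then u i + r i else u i - r i

lemma kk_nn_sum {s : Fin 3 → Bool} {u r : Fin 3 → ℕ} (h : ∀ i, s i = false → r i ≤ u i) :
    ∑ i, kk s u r i + 2 * ∑ i, nn s r i = ∑ i, u i + ∑ i, r i := by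
  rw [Finset.mul_sum, ← Finset.sum_add_distrib, ← Finset.sum_add_distrib]
  refine Finset.sum_congr rfl fun i _ => ?_
  cases hs : s i
  · have := h i hs
    simp only [kk, nn, hs, Bool.false_eq_true, if_false]
    omega
  · simp [kk, nn, hs]

lemma rescale {n k : Fin 3 → ℕ} {d : ℕ} {g : Fin 3 → MvPolynomial (Fin 2) F} (hg : Sc 0 k d g) :
    Sc n k (d + ∑ i, n i) (fun c => PP F n * g c) := by
  have hd : ∀ i, lf F i ^ n i ∣ PP F n := fun i => Finset.dvd_prod_of_mem _ (Finset.mem_univ i)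
  refine ⟨by linear_combination PP F n * hg.sum, fun c => ?_, fun i c => (hd i).mul_right _, fun i => ?_⟩
  · rw [add_comm]; exact (PP_hom n).mul (hg.hom c)
  · rw [pow_add]
    have := hg.own i
    simp only [Pi.zero_apply, zero_add] at this
    exact mul_dvd_mul (hd i) this

lemma Sc.smul {n k : Fin 3 → ℕ} {d : ℕ} {g : Fin 3 → MvPolynomial (Fin 2) F} (hg : Sc n k d g)
    (a : F) : Sc n k d (fun c => C a * g c) := by
  refine ⟨by linear_combination C a * hg.sum, fun c => ?_, fun i c => (hg.all i c).mul_left _, 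
    fun i => (hg.own i).mul_left _⟩
  exact (hg.hom c).C_mul a

/-- core composition lemma -/
lemma compose_core {p : ℕ} [Fact p.Prime] [CharP F p] (e : ℕ) {s : Fin 3 → Bool} {u r : Fin 3 → ℕ}
    {m : ℕ} (hu : ∑ i, u i = 2 * m) (hs : ∀ i, s i = false → 1 ≤ u i) (hr : ∀ i, r i ≤ p ^ e)
    (W : Fin 3 → Fin 3 → MvPolynomial (Fin 2) F)
    (hW : ∀ i, Sc (nn s (Pi.single i 1)) (kk s u (Pi.single i 1)) m (W i))
    (hsum : ∀ c, W 0 c + W 1 c + W 2 c = 0) (hdt : dt (W 0) (W 1) ≠ 0) :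
    gap F (kk s (fun i => u i * p ^ e) r) = gap F r := by
  obtain ⟨α, P, Q, hPQ⟩ := gap_spec (F := F) r
  obtain ⟨q, hq⟩ : ∃ q, q = p ^ e := ⟨_, rfl⟩
  rw [← hq] at hr ⊢
  have hfrob : ∀ x y z : MvPolynomial (Fin 2) F, x + y + z = 0 → x ^ q + y ^ q + z ^ q = 0 := by
    intro x y z h
    rw [hq, ← add_pow_char_pow, ← add_pow_char_pow, h]
    exact zero_pow (pow_ne_zero _ (Fact.out : p.Prime).ne_zero)
  let K : (Fin 3 → MvPolynomial (Fin 2) F) → Fin 3 → MvPolynomial (Fin 2) F :=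
    fun P c => dt P (fun i => W i c ^ q)
  have hrs : ∀ i, s i = false → r i ≤ u i * q := fun i hi =>
    (hr i).trans (Nat.le_mul_of_pos_left _ (hs i hi))
  have hK : ∀ d P, Sc 0 r d P → Sc (nn s r) (kk s (fun i => u i * q) r) (m * q + d) (K P) := by
    intro d P hP
    have hKi : ∀ i c, K P c = P i * W (i+1) c ^ q - P (i+1) * W i c ^ q := fun i c =>
      dt_cyc (h := fun i => W i c ^ q) hP.sum (hfrob _ _ _ (hsum c)) i
    have hPi : ∀ i, lf F i ^ r i ∣ P i := fun i => by simpa using hP.own i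
    have hi1 : ∀ i : Fin 3, i ≠ i + 1 := by decide
    refine ⟨?_, fun c => ?_, fun i c => ?_, fun i => ?_⟩
    · have h0 := hfrob _ _ _ (hW 0).sum
      have h1 := hfrob _ _ _ (hW 1).sum
      simp only [K, dt]
      linear_combination P 0 * h1 - P 1 * h0
    · have hd : d + m * q = m * q + d := by ring
      rw [← hd]
      exact ((hP.hom 0).mul (((hW 1).hom c).pow q)).sub ((hP.hom 1).mul (((hW 0).hom c).pow q))
    · rw [hKi i]
      cases hsi : s i
      · simp only [nn, hsi, Bool.false_eq_true, if_false]
        refine dvd_sub ((hPi i).mul_right _) (Dvd.dvd.mul_left ?_ _)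
        have := (hW i).all i c
        simp only [nn, hsi, Bool.false_eq_true, if_false, Pi.single_eq_same, pow_one] at this
        exact (pow_dvd_pow _ (hr i)).trans (pow_dvd_pow_of_dvd this q)
      · simp [nn, hsi]
    · rw [hKi i]
      have h1 := (hW (i+1)).own i
      have h2 := (hW i).own i
      have h1' : lf F i ^ (u i) ∣ W (i+1) i := by
        simpa [nn, kk, Pi.single_eq_of_ne (hi1 i)] using h1
      have h3 : lf F i ^ (r i + u i * q) ∣ P i * W (i+1) i ^ q := by
        rw [pow_add, pow_mul]
        exact mul_dvd_mul (hPi i) (pow_dvd_pow_of_dvd h1' q)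
      cases hsi : s i
      · have hui := hs i hsi
        have := hrs i hsi
        simp only [nn, kk, hsi, Bool.false_eq_true, if_false, Pi.single_eq_same] at h2 ⊢
        rw [Nat.add_sub_cancel' hui] at h2
        rw [Nat.add_sub_cancel' this]
        refine dvd_sub ((pow_dvd_pow _ (by omega)).trans h3) (Dvd.dvd.mul_left ?_ _)
        rw [pow_mul]
        exact pow_dvd_pow_of_dvd h2 q
      · simp only [nn, kk, hsi, if_true, Pi.single_eq_same, zero_add] at h2 ⊢
        refine dvd_sub (by rwa [add_comm]) (Dvd.dvd.mul_left ?_ _)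
        refine (pow_dvd_pow _ (?_ : u i * q + r i ≤ (u i + 1) * q)).trans ?_
        · have := hr i; rw [add_mul, one_mul]; omega
        · rw [pow_mul]
          exact pow_dvd_pow_of_dvd h2 q
  have hdet : dt (K P) (K Q) = dt P Q * dt (W 0) (W 1) ^ q := by
    have e1 : dt (W 0) (W 1) ^ q = W 0 0 ^ q * W 1 1 ^ q - W 0 1 ^ q * W 1 0 ^ q := by
      rw [dt, hq, sub_pow_char_pow, mul_pow, mul_pow]
    rw [e1]; simp only [K, dt]; ring
  have hne : dt (K P) (K Q) ≠ 0 := by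
    rw [hdet]; exact mul_ne_zero hPQ.det (pow_ne_zero _ hdt)
  have hP0 : K P ≠ 0 := by
    intro h; apply hne; rw [h]; simp [dt]
  have hQ0 : K Q ≠ 0 := by
    intro h; apply hne; rw [h]; simp [dt]
  obtain ⟨A, hA, hA', hle⟩ := descale (hK _ _ hPQ.memA) hP0
  obtain ⟨B, hB, hB', hle'⟩ := descale (hK _ _ hPQ.memB) hQ0
  have hBs : Bs (F := F) (kk s (fun i => u i * q) r) (m * q + α - ∑ i, nn s r i)
      (m * q + (α + gap F r) - ∑ i, nn s r i) A B := by
    refine ⟨hA, hB, ?_, ?_⟩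
    · intro h
      apply hne
      have : dt (K P) (K Q) = PP F (nn s r) ^ 2 * dt A B := by
        rw [dt, hA', hA', hB', hB', dt]; ring
      rw [this, h, mul_zero]
    · have h1 := kk_nn_sum hrs
      have h2 := hPQ.deg
      rw [← Finset.sum_mul, hu] at h1
      have : 2 * m * q = 2 * (m * q) := by ring
      omega
  exact (hasGap_of_Bs hBs _ (by omega)).eq

theorem compose {p : ℕ} [Fact p.Prime] [CharP F p] (e : ℕ) {s : Fin 3 → Bool} {u r : Fin 3 → ℕ}
    (hs : ∀ i, s i = false → 1 ≤ u i) (hr : ∀ i, r i ≤ p ^ e) (hu : gap F u = 0)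
    (hu2 : ∀ i, gap F (kk s u (Pi.single i 1 + Pi.single (i + 1) 1)) = 0) :
    gap F (kk s (fun i => u i * p ^ e) r) = gap F r := by
  obtain ⟨m, A, B, hAB⟩ := gap_spec (F := F) u
  rw [hu, add_zero] at hAB
  have hm : ∑ i, u i = 2 * m := by have := hAB.deg; omega
  have hgap1 : ∀ i, gap F (kk s u (Pi.single i 1)) = 1 := by
    intro i
    cases hsi : s i
    · have : kk s u (Pi.single i 1) + Pi.single i 1 = u := by
        funext j
        by_cases hj : j = i
        · subst hj; have := hs j hsi; simp [kk, hsi]; omega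
        · simp [kk, hj]
      have h := gap_lip (F := F) (kk s u (Pi.single i 1)) i
      rw [this] at h
      omega
    · have : kk s u (Pi.single i 1) = u + Pi.single i 1 := by
        funext j
        by_cases hj : j = i
        · subst hj; simp [kk, hsi]
        · simp [kk, hj]
      have h := gap_lip (F := F) u i
      rw [this]
      omega
  have hsr : ∀ i j, s j = false → (Pi.single i 1 : Fin 3 → ℕ) j ≤ u j := by
    intro i j hj
    have := hs j hj
    by_cases hij : j = i
    · subst hij; simpa
    · simp [hij]
  have hVex : ∀ i, ∃ V : Fin 3 → MvPolynomial (Fin 2) F,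
      Sc (nn s (Pi.single i 1)) (kk s u (Pi.single i 1)) m V ∧ V ≠ 0 := by
    intro i
    obtain ⟨d, g, hg, hg0, hd⟩ := gap_vec (F := F) (kk s u (Pi.single i 1))
    refine ⟨fun c => PP F (nn s (Pi.single i 1)) * g c, ?_, ?_⟩
    · have h1 := rescale (n := nn s (Pi.single i 1)) hg
      have h2 := kk_nn_sum (hsr i)
      rw [hgap1 i] at hd
      have h3 : ∑ j, (Pi.single i 1 : Fin 3 → ℕ) j = 1 := by simp
      have h4 : d + ∑ j, nn s (Pi.single i 1) j = m := by omega
      rw [h4] at h1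
      exact h1
    · intro h
      apply hg0
      funext c
      have := congrFun h c
      simpa [PP_ne_zero] using this
  choose V hV hV0 using hVex
  have hVu : ∀ i, Sc 0 u m (V i) := by
    intro i
    refine ⟨(hV i).sum, (hV i).hom, by simp, fun j => ?_⟩
    refine (pow_dvd_pow _ ?_).trans ((hV i).own j)
    cases hsj : s j
    · have := hsr i j hsj
      simp [nn, kk, hsj]; omega
    · simp [nn, kk, hsj]
  have hmm : m + m = ∑ i, u i := by omega
  have hd : ∀ i, ∃ c : F, c ≠ 0 ∧ dt (V i) (V (i+1)) = C c * PP F u := by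
    intro i
    obtain ⟨c, hc⟩ := dt_const (hVu i) (hVu (i+1)) hmm
    refine ⟨c, ?_, hc⟩
    rintro rfl
    rw [C_0, zero_mul] at hc
    have key : ∃ D, Sc 0 u m D ∧ dt D (V (i+1)) ≠ 0 := by
      by_contra hcon
      push Not at hcon
      apply hV0 (i+1)
      apply hAB.eq_zero (hV (i+1)).sum
      · rw [dt_swap, hcon A hAB.memA, neg_zero]
      · rw [dt_swap, hcon B hAB.memB, neg_zero]
    obtain ⟨D, hD, hDV⟩ := key
    obtain ⟨a, ha⟩ := dt_const hD (hVu (i+1)) hmm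
    obtain ⟨b, hb⟩ := dt_const hD (hVu i) hmm
    have hprop : ∀ c, C a * V i c = C b * V (i+1) c := by
      intro c
      have h := cramer (hVu i).sum (hVu (i+1)).sum hD.sum c
      rw [hc, dt_swap D, ha, hb] at h
      apply mul_left_cancel₀ (PP_ne_zero (F := F) u)
      linear_combination -h
    have ha0 : a ≠ 0 := by
      rintro rfl
      apply hDV; rw [ha]; simp
    have hi1 : ∀ i : Fin 3, i ≠ i + 1 := by decide
    have hX : Sc (nn s (Pi.single i 1 + Pi.single (i + 1) 1))
        (kk s u (Pi.single i 1 + Pi.single (i + 1) 1)) m (fun c => C a * V i c) := by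
      have h1 := (hV i).smul a
      have h2 := (hV (i+1)).smul b
      refine ⟨h1.sum, h1.hom, fun j c => ?_, fun j => ?_⟩
      · by_cases hj : j = i
        · have := h1.all j c
          subst hj
          simpa [nn, hi1 j] using this
        · have := h2.all j c
          simp only [← hprop] at this
          simpa [nn, hj] using this
      · by_cases hj : j = i
        · have := h1.own j
          subst hj
          simpa [nn, kk, hi1 j] using this
        · have := h2.own j
          simp only [← hprop] at this
          simpa [nn, kk, hj] using this
    have hX0 : (fun c => C a * V i c) ≠ 0 := by
      intro h
      apply hV0 i
      funext c
      have := congrFun h c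
      simpa [ha0] using this
    obtain ⟨g', hg', hg2, hle⟩ := descale hX hX0
    have hg0 : g' ≠ 0 := by
      rintro rfl
      apply hX0
      funext c
      rw [hg2]; simp
    have h1 := gap_min hg' hg0
    rw [hu2 i] at h1
    have h2 := kk_nn_sum (s := s) (u := u) (r := Pi.single i 1 + Pi.single (i + 1) 1) (by
      intro j hj
      have := hs j hj
      by_cases hij : j = i
      · subst hij; simpa [hi1 j]
      · by_cases hij' : j = i + 1
        · subst hij'; simpa [(hi1 i).symm]
        · simp [hij, hij'])
    have h3 : ∑ j, (Pi.single i 1 + Pi.single (i + 1) 1 : Fin 3 → ℕ) j = 2 := by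
      simp [Finset.sum_add_distrib]
    omega
  choose dd hd0 hdd using hd
  refine compose_core e hm hs hr ![fun c => C (dd 1) * V 0 c, fun c => C (dd 2) * V 1 c,
    fun c => C (dd 0) * V 2 c] ?_ ?_ ?_
  · intro i
    fin_cases i
    · exact (hV 0).smul _
    · exact (hV 1).smul _
    · exact (hV 2).smul _
  · intro c
    have h := cramer (hVu 0).sum (hVu 1).sum (hVu 2).sum c
    have e0 := hdd 0
    have e1 := hdd 1
    have e2 := hdd 2
    simp only [Fin.isValue, zero_add, Fin.reduceAdd] at e0 e1 e2
    rw [e0, e1, e2] at h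
    apply mul_left_cancel₀ (PP_ne_zero (F := F) u)
    simp only [Fin.isValue, Matrix.cons_val_zero, Matrix.cons_val_one, Matrix.cons_val, mul_zero]
    linear_combination h
  · have e0 := hdd 0
    simp only [Fin.isValue, zero_add] at e0
    have : dt (fun c => C (dd 1) * V 0 c) (fun c => C (dd 2) * V 1 c)
      = C (dd 1) * C (dd 2) * dt (V 0) (V 1) := by simp only [dt]; ring
    simp only [Fin.isValue, Matrix.cons_val_zero, Matrix.cons_val_one]
    rw [this, e0]
    simp [hd0, PP_ne_zero]

end comp
end HKaux


namespace HKaux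

section mason
variable {F : Type} [Field F]

/-- dehomogenization -/
noncomputable def dh (F : Type) [Field F] : MvPolynomial (Fin 2) F →ₐ[F] Polynomial F :=
  aeval ![Polynomial.X, 1]

lemma dh_inj {f : MvPolynomial (Fin 2) F} {d : ℕ} (hf : f.IsHomogeneous d) (h : dh F f = 0) :
    f = 0 := by
  have := Polynomial.homogenize_eq_of_isHomogeneous hf h
  rw [← this, Polynomial.homogenize_zero]

lemma dh_deg {f : MvPolynomial (Fin 2) F} {d : ℕ} (hf : f.IsHomogeneous d) :
    (dh F f).natDegree ≤ d := by
  have := MvPolynomial.aeval_natDegree_le (m := d) (n := 1) f hf.totalDegree_le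
    ![Polynomial.X, 1] (by intro i; fin_cases i <;> simp)
  simpa [dh] using this

open Polynomial in
lemma dvd_wr (l : Polynomial F) (n : ℕ) {G : Polynomial F} (h : l ^ n ∣ G) (H : Polynomial F) :
    l ^ (n - 1) ∣ Polynomial.wronskian G H := by
  rcases n with _ | n
  · simp
  obtain ⟨a, rfl⟩ := h
  rw [Polynomial.wronskian, Nat.add_sub_cancel, Polynomial.derivative_mul,
    Polynomial.derivative_pow_succ]
  refine ⟨l * a * derivative H - (Polynomial.C ((n : F) + 1) * derivative l * a + l * derivative a) * H, ?_⟩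
  ring

open Polynomial in
lemma prop_of_wr {p : ℕ} [Fact p.Prime] [CharP F p] {G H : Polynomial F} (hG : G ≠ 0) (hH : H ≠ 0)
    (hGd : G.natDegree < p) (hHd : H.natDegree < p) (h : Polynomial.wronskian G H = 0) :
    ∃ c : F, G = Polynomial.C c * H := by
  have hG0 : ∀ f : Polynomial F, f.natDegree < p → derivative f = 0 → f.natDegree = 0 := by
    intro f hf hd
    have hp := (Fact.out : p.Prime)
    have := Polynomial.expand_contract p hd hp.ne_zero
    rw [← this, Polynomial.natDegree_expand] at hf ⊢
    have h1 : (contract p f).natDegree = 0 := by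
      by_contra hne
      have := Nat.le_mul_of_pos_left p (Nat.pos_of_ne_zero hne)
      omega
    rw [h1, zero_mul]
  classical
  set D := EuclideanDomain.gcd G H with hD
  have hD0 : D ≠ 0 := by
    intro h0
    exact hG (EuclideanDomain.gcd_eq_zero_iff.1 h0).1
  obtain ⟨a, ha⟩ := EuclideanDomain.gcd_dvd_left G H
  obtain ⟨b, hb⟩ := EuclideanDomain.gcd_dvd_right G H
  rw [← hD] at ha hb
  have hcop : IsCoprime a b := by
    refine ⟨EuclideanDomain.gcdA G H, EuclideanDomain.gcdB G H, ?_⟩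
    have := EuclideanDomain.gcd_eq_gcd_ab G H
    apply mul_left_cancel₀ hD0
    rw [← hD] at this
    conv_rhs => rw [mul_one, this]
    conv_rhs => rw [ha, hb]
    rw [← ha, ← hb]
    linear_combination (-EuclideanDomain.gcdA G H) * ha - EuclideanDomain.gcdB G H * hb
  have hw : Polynomial.wronskian G H = D ^ 2 * Polynomial.wronskian a b := by
    rw [ha, hb]
    simp only [Polynomial.wronskian, Polynomial.derivative_mul]
    ring
  rw [hw] at h
  have hw0 : Polynomial.wronskian a b = 0 := by
    rcases mul_eq_zero.1 h with h | h
    · exact absurd h (pow_ne_zero _ hD0)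
    · exact h
  obtain ⟨hda, hdb⟩ := hcop.wronskian_eq_zero_iff.1 hw0
  have ha0 : a ≠ 0 := by rintro rfl; simp at ha; exact hG ha
  have hb0 : b ≠ 0 := by rintro rfl; simp at hb; exact hH hb
  have e1 : a.natDegree = 0 := by
    apply hG0 _ _ hda
    rw [ha, Polynomial.natDegree_mul hD0 ha0] at hGd
    omega
  have e2 : b.natDegree = 0 := by
    apply hG0 _ _ hdb
    rw [hb, Polynomial.natDegree_mul hD0 hb0] at hHd
    omega
  obtain ⟨x, rfl⟩ := Polynomial.natDegree_eq_zero.1 e1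
  obtain ⟨y, rfl⟩ := Polynomial.natDegree_eq_zero.1 e2
  have hy : y ≠ 0 := by rintro rfl; simp at hb0
  refine ⟨x / y, ?_⟩
  rw [ha, hb]
  have : (Polynomial.C x : Polynomial F) = Polynomial.C (x / y) * Polynomial.C y := by
    rw [← Polynomial.C_mul, div_mul_cancel₀ _ hy]
  rw [this]; ring

lemma sum3 (v : Fin 3 → ℕ) (i : Fin 3) : ∑ j, v j = v i + v (i+1) + v (i+2) := by
  fin_cases i <;> simp [Fin.sum_univ_three] <;> ring

theorem mason {p : ℕ} [Fact p.Prime] [CharP F p] {v : Fin 3 → ℕ} {d : ℕ}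
    {g : Fin 3 → MvPolynomial (Fin 2) F} (hg : Sc 0 v d g) (hd : 2 * d + 2 ≤ ∑ i, v i) (hdp : d < p)
    (htri : ∀ i, v i ≤ v (i+1) + v (i+2) + 1) : g = 0 := by
  have hown : ∀ i, lf F i ^ v i ∣ g i := fun i => by simpa using hg.own i
  have hph : ∀ i, (lf F i ^ v i).IsHomogeneous (v i) := fun i => by
    simpa using (lf_hom (F := F) i).pow (v i)
  by_contra hne
  -- no coordinate vanishes
  have hnz : ∀ i, g i ≠ 0 := by
    intro i hi
    have hcyc : g i + g (i+1) + g (i+2) = 0 := by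
      have := hg.sum
      fin_cases i
      · simpa using this
      · simpa using (by linear_combination this : g 1 + g 2 + g 0 = 0)
      · simpa using (by linear_combination this : g 2 + g 0 + g 1 = 0)
    have h12 : g (i+1) = - g (i+2) := by linear_combination hcyc - hi
    have h1 : g (i+1) ≠ 0 := by
      intro h1
      apply hne
      have h2 : g (i+2) = 0 := by rw [h1] at h12; simpa using h12.symm
      funext j
      have : j = i ∨ j = i+1 ∨ j = i+2 := by clear * -; revert i j; decide
      rcases this with rfl | rfl | rfl <;> assumption
    have hdv : lf F (i+1) ^ v (i+1) * lf F (i+2) ^ v (i+2) ∣ g (i+1) := by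
      apply IsRelPrime.mul_dvd (lf_pow_relprime (by clear * -; revert i; decide) _ _) (hown _)
      rw [h12]; exact (hown _).neg_right
    have := hom_dvd_le ((hph _).mul (hph _)) (hg.hom _) h1 hdv
    have := htri i
    rw [sum3 v i] at hd
    omega
  have hdhnz : ∀ i, dh F (g i) ≠ 0 := fun i h => hnz i (dh_inj (hg.hom i) h)
  have hsum : dh F (g 0) + dh F (g 1) + dh F (g 2) = 0 := by
    rw [← map_add, ← map_add, hg.sum, map_zero]
  by_cases hw : Polynomial.wronskian (dh F (g 0)) (dh F (g 1)) = 0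
  · obtain ⟨c, hc⟩ := prop_of_wr (p := p) (hdhnz 0) (hdhnz 1) ((dh_deg (hg.hom 0)).trans_lt hdp)
      ((dh_deg (hg.hom 1)).trans_lt hdp) hw
    have h0 : g 0 = C c * g 1 := by
      rw [← sub_eq_zero]
      apply dh_inj ((hg.hom 0).sub ((hg.hom 1).C_mul c))
      have : dh F (C c) = Polynomial.C c := by simp [dh]
      rw [map_sub, map_mul, hc, this, sub_self]
    have hc0 : c ≠ 0 := by rintro rfl; apply hnz 0; rw [h0]; simp
    have h2 : g 2 = C (-(c + 1)) * g 1 := by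
      have := hg.sum
      rw [h0] at this
      simp only [map_neg, map_add, map_one]
      linear_combination this
    have hc1 : -(c + 1) ≠ 0 := by intro h; apply hnz 2; rw [h2, h]; simp
    have hdv : PP F v ∣ g 1 := by
      apply PP_dvd
      intro i
      have hu : ∀ x : F, x ≠ 0 → IsUnit (C x : MvPolynomial (Fin 2) F) := fun x hx =>
        (isUnit_iff_ne_zero.2 hx).map C
      fin_cases i
      · exact ((hu c hc0).dvd_mul_left).1 (h0 ▸ hown 0)
      · exact hown 1
      · exact ((hu _ hc1).dvd_mul_left).1 (h2 ▸ hown 2)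
    have := hom_dvd_le (PP_hom v) (hg.hom 1) (hnz 1) hdv
    omega
  · have hdeg := Polynomial.natDegree_wronskian_lt_add hw
    obtain ⟨c, hc, hch, hcle⟩ := hom_dvd (pow_ne_zero _ (lf_ne_zero 1)) (hph 1) (hg.hom 1) (hown 1)
    have hcle := hcle (hnz 1)
    have hd1 : (dh F (g 1)).natDegree ≤ d - v 1 := by
      have : dh F (g 1) = dh F c := by
        rw [hc, map_mul, map_pow]; simp [dh, lf_one]
      rw [this]; exact dh_deg hch
    have hd0 := dh_deg (hg.hom 0)
    have e0 : dh F (lf F 0) = Polynomial.X := by simp [dh, lf_zero]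
    have e2 : dh F (lf F 2) = -(Polynomial.X + 1) := by simp [dh, lf_two]
    have k0 : Polynomial.X ^ (v 0 - 1) ∣ Polynomial.wronskian (dh F (g 0)) (dh F (g 1)) := by
      apply dvd_wr
      rw [← e0, ← map_pow]
      exact map_dvd _ (hown 0)
    have k2 : (-(Polynomial.X + 1)) ^ (v 2 - 1) ∣ Polynomial.wronskian (dh F (g 0)) (dh F (g 1)) := by
      rw [Polynomial.wronskian_eq_of_sum_zero hsum, ← Polynomial.wronskian_neg_eq, dvd_neg]
      apply dvd_wr
      rw [← e2, ← map_pow]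
      exact map_dvd _ (hown 2)
    have hcop : IsCoprime (Polynomial.X ^ (v 0 - 1) : Polynomial F) ((-(Polynomial.X + 1)) ^ (v 2 - 1)) := by
      apply IsCoprime.pow
      exact ⟨-1, -1, by ring⟩
    have hle := Polynomial.natDegree_le_of_dvd (hcop.mul_dvd k0 k2) hw
    have hX1 : (Polynomial.X + 1 : Polynomial F) ≠ 0 := by
      have := Polynomial.X_add_C_ne_zero (1 : F)
      simpa using this
    rw [Polynomial.natDegree_mul (pow_ne_zero _ Polynomial.X_ne_zero)
      (pow_ne_zero _ (neg_ne_zero.2 hX1)), Polynomial.natDegree_pow, Polynomial.natDegree_pow,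
      Polynomial.natDegree_neg, Polynomial.natDegree_X] at hle
    have : (Polynomial.X + 1 : Polynomial F).natDegree = 1 := by
      have := Polynomial.natDegree_X_add_C (1 : F)
      simpa using this
    rw [this, mul_one, mul_one] at hle
    rw [Fin.sum_univ_three] at hd
    omega

lemma gap_small {p : ℕ} [Fact p.Prime] [CharP F p] {v : Fin 3 → ℕ} (hp : ∑ i, v i < 2 * p + 2)
    (htri : ∀ i, v i ≤ v (i+1) + v (i+2) + 1) : gap F v ≤ 1 := by
  obtain ⟨d, g, hg, hg0, hd⟩ := gap_vec (F := F) v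
  by_contra hcon
  exact hg0 (mason (p := p) hg (by omega) (by omega) htri)

lemma gap_small_even {p : ℕ} [Fact p.Prime] [CharP F p] {v : Fin 3 → ℕ} (hp : ∑ i, v i < 2 * p + 2)
    (htri : ∀ i, v i ≤ v (i+1) + v (i+2) + 1) (he : Even (∑ i, v i)) : gap F v = 0 := by
  have := gap_small (F := F) hp htri
  obtain ⟨α, h⟩ := gap_parity (F := F) v
  obtain ⟨b, hb⟩ := he
  omega

/-- `gap (k,k,0) = 0` -/
lemma gap_kk0 (k : ℕ) : gap F ![k, k, 0] = 0 := by
  apply HasGap.eq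
  have hX : ∀ i : Fin 2, (X i ^ k : MvPolynomial (Fin 2) F).IsHomogeneous k := fun i => by
    simpa using (isHomogeneous_X F i).pow k
  refine ⟨k, ![X 0 ^ k, 0, - X 0 ^ k], ![0, X 1 ^ k, - X 1 ^ k], ⟨by simp, ?_, by simp, ?_⟩,
    ⟨by simp, ?_, by simp, ?_⟩, by simp [dt], ?_⟩
  · intro c; fin_cases c
    · exact hX 0
    · exact isHomogeneous_zero _ _ _
    · exact (hX 0).neg
  · intro c; fin_cases c <;> simp [lf]
  · intro c; fin_cases c
    · exact isHomogeneous_zero _ _ _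
    · exact hX 1
    · exact (hX 1).neg
  · intro c; fin_cases c <;> simp [lf]
  · simp [Fin.sum_univ_three]

lemma gap_large {r t : ℕ} (h : 2 * r ≤ t) : gap F ![r, r, t] = t - 2 * r := by
  have hX : ∀ i : Fin 2, (X i ^ r : MvPolynomial (Fin 2) F).IsHomogeneous r := fun i => by
    simpa using (isHomogeneous_X F i).pow r
  have hl : (lf F 2 ^ t).IsHomogeneous t := by simpa using (lf_hom (F := F) 2).pow t
  have hA : Sc (F := F) 0 ![r, r, t] (r + r) ![X 0 ^ r * X 1 ^ r, -(X 0 ^ r * X 1 ^ r), 0] := by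
    refine ⟨by simp, ?_, by simp, ?_⟩
    · intro c; fin_cases c
      · exact (hX 0).mul (hX 1)
      · exact ((hX 0).mul (hX 1)).neg
      · exact isHomogeneous_zero _ _ _
    · intro c; fin_cases c <;> simp [lf]
  have h1 := gap_min hA (by
    intro h0
    have := congrFun h0 0
    simp at this)
  obtain ⟨d, g, hg, hg0, hd⟩ := gap_vec (F := F) ![r, r, t]
  have hd2 : 2 * r ≤ d := by
    by_cases h2 : g 2 = 0
    · have hs := hg.sum
      have h01 : g 0 = - g 1 := by linear_combination hs - h2
      have h0 : g 0 ≠ 0 := by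
        intro h0
        apply hg0
        funext j
        fin_cases j
        · exact h0
        · simpa [h0] using h01.symm
        · exact h2
      have o0 : lf F 0 ^ r ∣ g 0 := by simpa using hg.own 0
      have o1 : lf F 1 ^ r ∣ g 0 := by rw [h01, dvd_neg]; simpa using hg.own 1
      have := hom_dvd_le ((hX 0).mul (hX 1)) (hg.hom 0) h0
        ((lf_pow_relprime (i := 0) (j := 1) (by decide) r r).mul_dvd o0 o1)
      omega
    · have o2 : lf F 2 ^ t ∣ g 2 := by simpa using hg.own 2
      have := hom_dvd_le hl (hg.hom 2) h2 o2
      omega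
  simp [Fin.sum_univ_three] at h1 hd
  omega

end mason
end HKaux


namespace HKaux

section recur
variable {F : Type} [Field F]

/-- abbreviation for gaps with two equal arguments -/
noncomputable def ga (F : Type) [Field F] (k t : ℕ) : ℕ := gap F ![k, k, t]

lemma gap3 {p : ℕ} [Fact p.Prime] [CharP F p] (v : Fin 3 → ℕ) (x y z : ℕ) (hv : v = ![x, y, z])
    (h : x + y + z < 2 * p + 2)
    (h1 : x ≤ y + z + 1) (h2 : y ≤ x + z + 1) (h3 : z ≤ x + y + 1) (h4 : (x + y + z) % 2 = 0) :
    gap F v = 0 := by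
  subst hv
  apply gap_small_even (p := p)
  · simpa [Fin.sum_univ_three] using h
  · intro i; fin_cases i <;> simp <;> omega
  · rw [Nat.even_iff]; simpa [Fin.sum_univ_three] using h4

lemma ga_ppp {p : ℕ} [Fact p.Prime] [CharP F p] (e a j r τ : ℕ) (hp : 4 * a + 1 = p)
    (hj : j % 2 = 0) (hja : j ≤ 2 * a) (hr : r ≤ p ^ e) (hτ : τ ≤ p ^ e) :
    ga F (a * p ^ e + r) (j * p ^ e + τ) = ga F r τ := by
  have := compose (F := F) (p := p) e (s := ![true, true, true]) (u := ![a, a, j]) (r := ![r, r, τ])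
    (by intro i; fin_cases i <;> simp) (by intro i; fin_cases i <;> simpa)
    (gap3 (p := p) _ a a j rfl (by omega) (by omega) (by omega) (by omega) (by omega)) (by
      intro i; fin_cases i
      · exact gap3 (p := p) _ (a+1) (a+1) j (by funext j; fin_cases j <;> simp [kk])
          (by omega) (by omega) (by omega) (by omega) (by omega)
      · exact gap3 (p := p) _ a (a+1) (j+1) (by funext j; fin_cases j <;> simp [kk])
          (by omega) (by omega) (by omega) (by omega) (by omega)
      · exact gap3 (p := p) _ (a+1) a (j+1) (by funext j; fin_cases j <;> simp [kk])
          (by omega) (by omega) (by omega) (by omega) (by omega))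
  rw [ga, ga, ← this]
  congr 1
  funext j; fin_cases j <;> simp [kk]

lemma ga_ppm {p : ℕ} [Fact p.Prime] [CharP F p] (e a j r τ : ℕ) (hp : 4 * a + 1 = p)
    (hj : j % 2 = 0) (hj0 : 2 ≤ j) (hja : j ≤ 2 * a) (hr : r ≤ p ^ e) (hτ : τ ≤ p ^ e) :
    ga F (a * p ^ e + r) (j * p ^ e - τ) = ga F r τ := by
  have := compose (F := F) (p := p) e (s := ![true, true, false]) (u := ![a, a, j]) (r := ![r, r, τ])
    (by intro i; fin_cases i <;> simp; omega) (by intro i; fin_cases i <;> simpa)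
    (gap3 (p := p) _ a a j rfl (by omega) (by omega) (by omega) (by omega) (by omega)) (by
      intro i; fin_cases i
      · exact gap3 (p := p) _ (a+1) (a+1) j (by funext j; fin_cases j <;> simp [kk])
          (by omega) (by omega) (by omega) (by omega) (by omega)
      · exact gap3 (p := p) _ a (a+1) (j-1) (by funext j; fin_cases j <;> simp [kk])
          (by omega) (by omega) (by omega) (by omega) (by omega)
      · exact gap3 (p := p) _ (a+1) a (j-1) (by funext j; fin_cases j <;> simp [kk])
          (by omega) (by omega) (by omega) (by omega) (by omega))
  rw [ga, ga, ← this]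
  congr 1
  funext j; fin_cases j <;> simp [kk]

lemma ga_mmp {p : ℕ} [Fact p.Prime] [CharP F p] (e a j r τ : ℕ) (hp : 4 * a = p + 1)
    (hj : j % 2 = 0) (hja : j + 2 ≤ 2 * a) (hr : r ≤ p ^ e) (hτ : τ ≤ p ^ e) :
    ga F (a * p ^ e - r) (j * p ^ e + τ) = ga F r τ := by
  have := compose (F := F) (p := p) e (s := ![false, false, true]) (u := ![a, a, j]) (r := ![r, r, τ])
    (by intro i; fin_cases i <;> simp <;> omega) (by intro i; fin_cases i <;> simpa)
    (gap3 (p := p) _ a a j rfl (by omega) (by omega) (by omega) (by omega) (by omega)) (by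
      intro i; fin_cases i
      · exact gap3 (p := p) _ (a-1) (a-1) j (by funext j; fin_cases j <;> simp [kk])
          (by omega) (by omega) (by omega) (by omega) (by omega)
      · exact gap3 (p := p) _ a (a-1) (j+1) (by funext j; fin_cases j <;> simp [kk])
          (by omega) (by omega) (by omega) (by omega) (by omega)
      · exact gap3 (p := p) _ (a-1) a (j+1) (by funext j; fin_cases j <;> simp [kk])
          (by omega) (by omega) (by omega) (by omega) (by omega))
  rw [ga, ga, ← this]
  congr 1
  funext j; fin_cases j <;> simp [kk]

lemma ga_mmm {p : ℕ} [Fact p.Prime] [CharP F p] (e a j r τ : ℕ) (hp : 4 * a = p + 1)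
    (hj : j % 2 = 0) (hj0 : 2 ≤ j) (hja : j + 2 ≤ 2 * a) (hr : r ≤ p ^ e) (hτ : τ ≤ p ^ e) :
    ga F (a * p ^ e - r) (j * p ^ e - τ) = ga F r τ := by
  have := compose (F := F) (p := p) e (s := ![false, false, false]) (u := ![a, a, j]) (r := ![r, r, τ])
    (by intro i; fin_cases i <;> simp <;> omega) (by intro i; fin_cases i <;> simpa)
    (gap3 (p := p) _ a a j rfl (by omega) (by omega) (by omega) (by omega) (by omega)) (by
      intro i; fin_cases i
      · exact gap3 (p := p) _ (a-1) (a-1) j (by funext j; fin_cases j <;> simp [kk])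
          (by omega) (by omega) (by omega) (by omega) (by omega)
      · exact gap3 (p := p) _ a (a-1) (j-1) (by funext j; fin_cases j <;> simp [kk])
          (by omega) (by omega) (by omega) (by omega) (by omega)
      · exact gap3 (p := p) _ (a-1) a (j-1) (by funext j; fin_cases j <;> simp [kk])
          (by omega) (by omega) (by omega) (by omega) (by omega))
  rw [ga, ga, ← this]
  congr 1
  funext j; fin_cases j <;> simp [kk]

lemma ga_zero (k : ℕ) : ga F k 0 = 0 := gap_kk0 k

lemma ga_large {k t : ℕ} (h : 2 * k ≤ t) : ga F k t = t - 2 * k := gap_large h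

lemma ga_lip (k t : ℕ) : ga F k (t + 1) = ga F k t + 1 ∨ ga F k (t + 1) + 1 = ga F k t := by
  have h := gap_lip (F := F) ![k, k, t] 2
  have e : ![k, k, t] + Pi.single 2 1 = ![k, k, t + 1] := by
    funext j; fin_cases j <;> simp
  rw [e] at h
  exact h

lemma ga_lip_k (k t : ℕ) : ga F (k + 1) t ≤ ga F k t + 2 ∧ ga F k t ≤ ga F (k + 1) t + 2 := by
  have h := gap_lip (F := F) ![k, k, t] 0
  have e : ![k, k, t] + Pi.single 0 1 = ![k + 1, k, t] := by
    funext j; fin_cases j <;> simp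
  have h2 := gap_lip (F := F) ![k + 1, k, t] 1
  have e2 : ![k + 1, k, t] + Pi.single 1 1 = ![k + 1, k + 1, t] := by
    funext j; fin_cases j <;> simp
  rw [e] at h
  rw [e2] at h2
  simp only [ga]
  omega

lemma ga_lip_add (k t s : ℕ) : ga F k (t + s) ≤ ga F k t + s ∧ ga F k t ≤ ga F k (t + s) + s := by
  induction s with
  | zero => simp
  | succ s ih => have := ga_lip (F := F) k (t + s); rw [← add_assoc]; omega

lemma ga_le (k t : ℕ) : ga F k t ≤ t := by
  have := ga_lip_add (F := F) k 0 t
  rw [ga_zero, zero_add] at this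
  omega

/-- the sum of squared gaps -/
noncomputable def SS (F : Type) [Field F] (k : ℕ) : ℕ := ∑ t ∈ Finset.range (2 * k), ga F k t ^ 2

lemma sum_sq (M : ℕ) : 6 * ∑ m ∈ Finset.range M, (m : ℝ) ^ 2 = M * (M - 1) * (2 * M - 1) := by
  induction M with
  | zero => simp
  | succ M ih => rw [Finset.sum_range_succ, mul_add, ih]; push_cast; ring

/-- block decomposition -/
lemma sum_blocks (f : ℕ → ℝ) (q a : ℕ) (c : ℝ)
    (h : ∀ b < a, ∑ τ ∈ Finset.range (2 * q), f (2 * b * q + τ) = c) :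
    ∑ t ∈ Finset.range (2 * a * q), f t = a * c := by
  induction a with
  | zero => simp
  | succ a ih =>
    have e : 2 * (a + 1) * q = 2 * a * q + 2 * q := by ring
    rw [e, Finset.sum_range_add, ih (fun b hb => h b (by omega)), h a (by omega)]
    push_cast; ring

/-- the sum over a full period -/
lemma BB (r M : ℕ) : ∑ τ ∈ Finset.range (2 * r + M), (ga F r τ : ℝ) ^ 2
    = SS F r + M * (M - 1) * (2 * M - 1) / 6 := by
  rw [Finset.sum_range_add, SS]
  push_cast
  congr 1
  rw [← sum_sq, mul_div_cancel_left₀ _ (by norm_num)]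
  refine Finset.sum_congr rfl fun x _ => ?_
  rw [ga_large (by omega)]
  simp

/-- sum over a double block -/
lemma block (f : ℕ → ℕ) (r M q o : ℕ) (hq : q = 2 * r + M) 
    (h1 : ∀ τ ≤ q, f (o + τ) = ga F r τ) (h2 : ∀ τ ≤ q, f (o + 2 * q - τ) = ga F r τ) :
    ∑ τ ∈ Finset.range (2 * q), (f (o + τ) : ℝ) ^ 2
    = 2 * (SS F r) + (2 * (M:ℝ) ^ 3 + M) / 3 := by
  have e : 2 * q = q + q := by ring
  have hA : ∑ τ ∈ Finset.range q, (f (o + τ) : ℝ) ^ 2 = ∑ τ ∈ Finset.range q, (ga F r τ : ℝ) ^ 2 :=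
    Finset.sum_congr rfl fun τ hτ => by rw [h1 τ (Finset.mem_range.1 hτ).le]
  have hB : ∑ τ ∈ Finset.range q, (f (o + (q + τ)) : ℝ) ^ 2
      = ∑ τ ∈ Finset.range q, (ga F r (τ + 1) : ℝ) ^ 2 := by
    rw [← Finset.sum_range_reflect]
    refine Finset.sum_congr rfl fun τ hτ => ?_
    have := Finset.mem_range.1 hτ
    rw [← h2 (τ + 1) (by omega)]
    congr 3
    omega
  have hC := Finset.sum_range_succ' (fun τ => (ga F r τ : ℝ) ^ 2) q
  rw [Finset.sum_range_succ] at hC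
  rw [ga_zero, ga_large (k := r) (t := q) (by omega)] at hC
  have e3 : q - 2 * r = M := by omega
  rw [e3] at hC
  have hD := BB (F := F) r M
  rw [← hq] at hD
  rw [e, Finset.sum_range_add, hA, hB]
  rw [hD] at hC ⊢
  push_cast at hC
  linear_combination -hC

lemma rec1 {p : ℕ} [Fact p.Prime] [CharP F p] (e a r M : ℕ) (hp : 4 * a + 1 = p)
    (hq : p ^ e = 2 * r + M) :
    (SS F (a * p ^ e + r) : ℝ) = (2 * a + 1) * SS F r + a * (2 * (M:ℝ) ^ 3 + M) / 3 := by
  have h1 := sum_blocks (fun t => (ga F (a * p ^ e + r) t : ℝ) ^ 2) (p ^ e) a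
    (2 * (SS F r) + (2 * (M:ℝ) ^ 3 + M) / 3) (by
      intro b hb
      apply block (F := F) (fun t => ga F (a * p ^ e + r) t) r M (p ^ e) (2 * b * p ^ e) hq
      · intro τ hτ
        exact ga_ppp e a (2 * b) r τ hp (by omega) (by omega) (by omega) hτ
      · intro τ hτ
        have := ga_ppm (F := F) e a (2 * b + 2) r τ hp (by omega) (by omega) (by omega) (by omega) hτ
        rw [← this]
        congr 2
        ring)
  have e1 : 2 * (a * p ^ e + r) = 2 * a * p ^ e + 2 * r := by ring
  have h2 : ∑ τ ∈ Finset.range (2 * r), (ga F (a * p ^ e + r) (2 * a * p ^ e + τ) : ℝ) ^ 2 = SS F r := by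
    rw [SS]; push_cast
    refine Finset.sum_congr rfl fun τ hτ => ?_
    have := Finset.mem_range.1 hτ
    rw [ga_ppp e a (2 * a) r τ hp (by omega) le_rfl (by omega) (by omega)]
  rw [SS, e1, Finset.sum_range_add]
  push_cast
  rw [h1, h2]
  ring

lemma rec3 {p : ℕ} [Fact p.Prime] [CharP F p] (e a r M : ℕ) (hp : 4 * a = p + 1)
    (hq : p ^ e = 2 * r + M) :
    (SS F (a * p ^ e - r) : ℝ) = (2 * a - 1) * SS F r + a * (2 * (M:ℝ) ^ 3 + M) / 3 := by
  obtain ⟨b, rfl⟩ : ∃ b, a = b + 1 := ⟨a - 1, by omega⟩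
  have h1 := sum_blocks (fun t => (ga F ((b + 1) * p ^ e - r) t : ℝ) ^ 2) (p ^ e) b
    (2 * (SS F r) + (2 * (M:ℝ) ^ 3 + M) / 3) (by
      intro c hb
      apply block (F := F) (fun t => ga F ((b + 1) * p ^ e - r) t) r M (p ^ e) (2 * c * p ^ e) hq
      · intro τ hτ
        exact ga_mmp e (b + 1) (2 * c) r τ hp (by omega) (by omega) (by omega) hτ
      · intro τ hτ
        have := ga_mmm (F := F) e (b + 1) (2 * c + 2) r τ hp (by omega) (by omega) (by omega) (by omega) hτ
        rw [← this]
        congr 2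
        ring)
  have e1 : 2 * ((b + 1) * p ^ e - r) = 2 * b * p ^ e + p ^ e + M := by
    have : 2 * ((b + 1) * p ^ e) = 2 * b * p ^ e + 2 * p ^ e := by ring
    omega
  have hb : ∀ τ ≤ p ^ e, ga F ((b + 1) * p ^ e - r) (2 * b * p ^ e + τ) = ga F r τ := fun τ hτ =>
    ga_mmp e (b + 1) (2 * b) r τ hp (by omega) (by omega) (by omega) hτ
  have h2 : ∑ τ ∈ Finset.range (p ^ e), (ga F ((b + 1) * p ^ e - r) (2 * b * p ^ e + τ) : ℝ) ^ 2
      = SS F r + M * (M - 1) * (2 * M - 1) / 6 := by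
    rw [← BB, ← hq]
    refine Finset.sum_congr rfl fun τ hτ => ?_
    rw [hb τ (Finset.mem_range.1 hτ).le]
  have h3 : ∑ τ ∈ Finset.range M, (ga F ((b + 1) * p ^ e - r) (2 * b * p ^ e + p ^ e + τ) : ℝ) ^ 2
      = M * (M + 1) * (2 * M + 1) / 6 := by
    have hM := sum_sq (M + 1)
    rw [Finset.sum_range_succ'] at hM
    push_cast at hM
    have : (M:ℝ) * (M + 1) * (2 * M + 1) / 6 = ∑ m ∈ Finset.range M, ((m : ℝ) + 1) ^ 2 := by
      linear_combination -hM / 6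
    rw [this, ← Finset.sum_range_reflect]
    refine Finset.sum_congr rfl fun τ hτ => ?_
    have hτ := Finset.mem_range.1 hτ
    have g0 := hb (p ^ e) le_rfl
    rw [ga_large (k := r) (t := p ^ e) (by omega)] at g0
    have g1 : ga F ((b + 1) * p ^ e - r) (2 * b * p ^ e + p ^ e + M) = 0 := by
      rw [ga_large (by omega)]; omega
    have l1 := ga_lip_add (F := F) ((b + 1) * p ^ e - r) (2 * b * p ^ e + p ^ e) (M - 1 - τ)
    have l2 := ga_lip_add (F := F) ((b + 1) * p ^ e - r) (2 * b * p ^ e + p ^ e + (M - 1 - τ)) (τ + 1)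
    have e2 : 2 * b * p ^ e + p ^ e + (M - 1 - τ) + (τ + 1) = 2 * b * p ^ e + p ^ e + M := by omega
    rw [e2, g1] at l2
    have : ga F ((b + 1) * p ^ e - r) (2 * b * p ^ e + p ^ e + (M - 1 - τ)) = τ + 1 := by omega
    rw [this]; push_cast; ring
  rw [SS, e1, Finset.sum_range_add, Finset.sum_range_add]
  push_cast
  rw [h1, h2, h3]
  ring

end recur
end HKaux


namespace HKaux

section asym

lemma asym_core {c ρ ε p q s x M : ℝ} (hc : 0 ≤ c) (hρ : 0 ≤ ρ) (hε : ε * p ^ 3 = ε * ρ + c / 12)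
    (hq : 1 ≤ q) (hs1 : s ^ 2 = 1) (hM : 2 * M = q + s) (hx : |x - ε * q ^ 3| ≤ c * q ^ 2)
    (hp : ρ + 1 ≤ p ^ 2) :
    |ρ * x + c * (2 * M ^ 3 + M) / 3 - ε * (p * q) ^ 3| ≤ c * (p * q) ^ 2 := by
  have hM' : M = (q + s) / 2 := by linarith
  have hs : -1 ≤ s ∧ s ≤ 1 := abs_le.1 (by rw [← sq_le_one_iff_abs_le_one, hs1])
  have e : ρ * x + c * (2 * M ^ 3 + M) / 3 - ε * (p * q) ^ 3
      = ρ * (x - ε * q ^ 3) + c * ((3 * s * q ^ 2 + 5 * q + 3 * s) / 12) := by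
    have : s ^ 3 = s := by rw [pow_succ, hs1, one_mul]
    rw [hM']
    linear_combination (-q ^ 3) * hε + c / 12 * this + c * q / 4 * hs1
  have h1 : |(3 * s * q ^ 2 + 5 * q + 3 * s) / 12| ≤ q ^ 2 := by
    rw [abs_le]
    constructor <;> nlinarith
  rw [e]
  calc _ ≤ |ρ * (x - ε * q ^ 3)| + |c * ((3 * s * q ^ 2 + 5 * q + 3 * s) / 12)| := abs_add_le _ _
    _ = ρ * |x - ε * q ^ 3| + c * |(3 * s * q ^ 2 + 5 * q + 3 * s) / 12| := by
      rw [abs_mul, abs_mul, abs_of_nonneg hρ, abs_of_nonneg hc]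
    _ ≤ ρ * (c * q ^ 2) + c * q ^ 2 := by gcongr
    _ = (ρ + 1) * (c * q ^ 2) := by ring
    _ ≤ p ^ 2 * (c * q ^ 2) := by gcongr
    _ = _ := by ring

variable {F : Type} [Field F]

lemma asym1 {p : ℕ} [Fact p.Prime] [CharP F p] (a : ℕ) (hp : 4 * a + 1 = p) (n : ℕ) :
    ∃ k, (4 * k ≤ p ^ n + 1 ∧ p ^ n ≤ 4 * k + 1) ∧ 4 * k + 1 = p ^ n ∧
      |(SS F k : ℝ) - 1 / 24 / (2 * (p : ℝ) ^ 2 + 2 * p + 1) * ((p : ℝ) ^ n) ^ 3|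
        ≤ a * ((p : ℝ) ^ n) ^ 2 := by
  have hp2 := (Fact.out : p.Prime).two_le
  have ha1 : (1:ℝ) ≤ a := by
    have : 1 ≤ a := by omega
    exact_mod_cast this
  have hpr : (p : ℝ) = 4 * a + 1 := by rw [← hp]; push_cast; ring
  have hpos : (0:ℝ) < 2 * (p : ℝ) ^ 2 + 2 * p + 1 := by positivity
  induction n with
  | zero =>
    refine ⟨0, by simp, by simp, ?_⟩
    simp only [SS, mul_zero, Finset.range_zero, Finset.sum_empty, Nat.cast_zero, pow_zero, one_pow,
      mul_one, zero_sub, abs_neg]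
    rw [abs_of_nonneg (by positivity), div_le_iff₀ hpos]
    nlinarith
  | succ n ih =>
    obtain ⟨k, -, hk, hx⟩ := ih
    refine ⟨a * p ^ n + k, ?_, ?_, ?_⟩
    · rw [pow_succ, ← hk, ← hp]; constructor <;> nlinarith
    · rw [pow_succ, ← hk, ← hp]; ring
    · rw [rec1 (F := F) n a k (2 * k + 1) hp (by omega), pow_succ' (p:ℝ) n]
      apply asym_core (s := 1) (by positivity) (by positivity) _ _ (by norm_num) _ hx _
      · rw [hpr]
        have : (2 * (4 * (a:ℝ) + 1) ^ 2 + 2 * (4 * a + 1) + 1) ≠ 0 := by positivity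
        field_simp
        ring
      · have : 1 ≤ p ^ n := by omega
        exact_mod_cast this
      · push_cast
        have : ((p:ℝ) ^ n) = 4 * k + 1 := by exact_mod_cast hk.symm
        rw [this]; ring
      · rw [hpr]; nlinarith

lemma asym3 {p : ℕ} [Fact p.Prime] [CharP F p] (a : ℕ) (hp : 4 * a = p + 1) (n : ℕ) :
    ∃ k, (4 * k ≤ p ^ n + 1 ∧ p ^ n ≤ 4 * k + 1) ∧ (4 * k + 1 = p ^ n ∨ 4 * k = p ^ n + 1) ∧
      |(SS F k : ℝ) - 1 / 24 / (2 * (p : ℝ) ^ 2 - 2 * p + 1) * ((p : ℝ) ^ n) ^ 3|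
        ≤ a * ((p : ℝ) ^ n) ^ 2 := by
  have hp2 := (Fact.out : p.Prime).two_le
  have ha1 : (1:ℝ) ≤ a := by
    have : 1 ≤ a := by omega
    exact_mod_cast this
  have hpr : (p : ℝ) = 4 * a - 1 := by
    have : (4 * a : ℝ) = p + 1 := by exact_mod_cast hp
    linarith
  have hpos : (0:ℝ) < 2 * (p : ℝ) ^ 2 - 2 * p + 1 := by nlinarith
  induction n with
  | zero =>
    refine ⟨0, by simp, by simp, ?_⟩
    simp only [SS, mul_zero, Finset.range_zero, Finset.sum_empty, Nat.cast_zero, pow_zero, one_pow,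
      mul_one, zero_sub, abs_neg]
    rw [abs_of_nonneg (by positivity), div_le_iff₀ hpos]
    nlinarith
  | succ n ih =>
    obtain ⟨k, -, hk, hx⟩ := ih
    have hq1 : 1 ≤ p ^ n := Nat.one_le_pow _ _ (by omega)
    have hkq : k ≤ p ^ n := by omega
    have hkq' : 2 * k ≤ p ^ n := by omega
    have haq : p ^ n ≤ a * p ^ n := Nat.le_mul_of_pos_left _ (by omega)
    have h4 : 4 * (a * p ^ n) = p ^ n * p + p ^ n := by
      rw [← mul_assoc, hp]; ring
    have hor : 4 * (a * p ^ n - k) + 1 = p ^ (n + 1) ∨ 4 * (a * p ^ n - k) = p ^ (n + 1) + 1 := by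
      rw [pow_succ]
      omega
    refine ⟨a * p ^ n - k, by omega, hor, ?_⟩
    rw [rec3 (F := F) n a k (p ^ n - 2 * k) hp (by omega), pow_succ' (p:ℝ) n]
    apply asym_core (s := (p:ℝ) ^ n - 4 * k) (by positivity) (by linarith) _ _ _ _ hx _
    · obtain ⟨D, hD⟩ : ∃ D, D = 2 * (p : ℝ) ^ 2 - 2 * p + 1 := ⟨_, rfl⟩
      have key : (p:ℝ) ^ 3 = (2 * a - 1) + 2 * a * D := by rw [hD, hpr]; ring
      have hD0 : D ≠ 0 := by rw [hD]; exact hpos.ne'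
      rw [← hD, key]
      field_simp
      ring
    · exact_mod_cast hq1
    · rcases hk with hk | hk
      · have : ((p:ℝ) ^ n) = 4 * k + 1 := by exact_mod_cast hk.symm
        rw [this]; ring
      · have : ((p:ℝ) ^ n) + 1 = 4 * k := by exact_mod_cast hk.symm
        rw [← this]; ring
    · rw [Nat.cast_sub hkq']; push_cast; ring
    · rw [hpr]; nlinarith

/-- comparison of neighbouring sums -/
lemma SS_lip (k : ℕ) : |(SS F (k + 1) : ℝ) - SS F k| ≤ 100 * ((k : ℝ) + 1) ^ 2 := by
  have e : 2 * (k + 1) = 2 * k + 1 + 1 := by ring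
  have h1 : (SS F (k + 1) : ℝ) - SS F k = ∑ t ∈ Finset.range (2 * k),
      ((ga F (k + 1) t : ℝ) ^ 2 - (ga F k t : ℝ) ^ 2) + (ga F (k + 1) (2 * k) : ℝ) ^ 2 +
        (ga F (k + 1) (2 * k + 1) : ℝ) ^ 2 := by
    rw [SS, SS, e, Finset.sum_range_succ, Finset.sum_range_succ, Finset.sum_sub_distrib]
    push_cast; ring
  have h2 : |∑ t ∈ Finset.range (2 * k), ((ga F (k + 1) t : ℝ) ^ 2 - (ga F k t : ℝ) ^ 2)|
      ≤ ∑ t ∈ Finset.range (2 * k), (2 * (4 * (k:ℝ) + 2)) := by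
    refine (Finset.abs_sum_le_sum_abs _ _).trans (Finset.sum_le_sum fun t ht => ?_)
    have ht := Finset.mem_range.1 ht
    obtain ⟨l1, l2⟩ := ga_lip_k (F := F) k t
    have g1 := ga_le (F := F) k t
    have g2 := ga_le (F := F) (k + 1) t
    have l1' : (ga F (k + 1) t : ℝ) ≤ ga F k t + 2 := by exact_mod_cast l1
    have l2' : (ga F k t : ℝ) ≤ ga F (k + 1) t + 2 := by exact_mod_cast l2
    have g1' : (ga F k t : ℝ) ≤ 2 * k := by exact_mod_cast (by omega : ga F k t ≤ 2 * k)
    have g2' : (ga F (k + 1) t : ℝ) ≤ 2 * k := by exact_mod_cast (by omega : ga F (k+1) t ≤ 2 * k)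
    have n1 : (0:ℝ) ≤ ga F k t := by positivity
    have n2 : (0:ℝ) ≤ ga F (k + 1) t := by positivity
    rw [sq_sub_sq, abs_mul, abs_of_nonneg (by positivity)]
    have : |(ga F (k + 1) t : ℝ) - ga F k t| ≤ 2 := abs_le.2 ⟨by linarith, by linarith⟩
    have h3 : (ga F (k + 1) t : ℝ) + ga F k t ≤ 4 * k + 2 := by linarith
    calc _ ≤ (4 * (k:ℝ) + 2) * 2 := by gcongr
      _ = _ := by ring
  rw [Finset.sum_const, Finset.card_range, nsmul_eq_mul] at h2
  push_cast at h2
  have g1 := ga_le (F := F) (k + 1) (2 * k)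
  have g2 := ga_le (F := F) (k + 1) (2 * k + 1)
  have g1' : (ga F (k + 1) (2 * k) : ℝ) ≤ 2 * k := by exact_mod_cast g1
  have g2' : (ga F (k + 1) (2 * k + 1) : ℝ) ≤ 2 * k + 1 := by exact_mod_cast g2
  have g3 : (ga F (k + 1) (2 * k) : ℝ) ^ 2 ≤ (2 * k) ^ 2 := by gcongr
  have g4 : (ga F (k + 1) (2 * k + 1) : ℝ) ^ 2 ≤ (2 * k + 1) ^ 2 := by gcongr
  have n1 : (0:ℝ) ≤ (ga F (k + 1) (2 * k) : ℝ) ^ 2 := by positivity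
  have n2 : (0:ℝ) ≤ (ga F (k + 1) (2 * k + 1) : ℝ) ^ 2 := by positivity
  have hk : (0:ℝ) ≤ k := by positivity
  rw [h1]
  rw [abs_le] at h2 ⊢
  constructor <;> nlinarith

end asym
end HKaux


namespace HKaux

section dims
variable {F : Type} [Field F]

/-- the ideal generated by `N`-th powers of the two variables -/
noncomputable def AI (F : Type) [Field F] (N : ℕ) : Ideal (MvPolynomial (Fin 2) F) :=
  Ideal.span {X 0 ^ N, X 1 ^ N}

/-- the quartic form in two variables -/
noncomputable def TT (F : Type) [Field F] : MvPolynomial (Fin 2) F := X 0 ^ 4 + X 1 ^ 4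

lemma monomial_two (s : Fin 2 →₀ ℕ) (c : F) :
    (monomial s c : MvPolynomial (Fin 2) F) = c • (X 0 ^ s 0 * X 1 ^ s 1) := by
  rw [monomial_eq, Finsupp.prod_fintype _ _ (by simp), Fin.prod_univ_two, MvPolynomial.smul_eq_C_mul]

lemma AI_span (N : ℕ) :
    Submodule.span F (Set.range fun s : ℕ × ℕ =>
      Ideal.Quotient.mk (AI F N) (X 0 ^ s.1 * X 1 ^ s.2)) = ⊤ := by
  rw [eq_top_iff]
  intro x _
  obtain ⟨f, rfl⟩ := Ideal.Quotient.mk_surjective x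
  induction f using MvPolynomial.induction_on' with
  | monomial s c =>
    rw [monomial_two]
    have : (Ideal.Quotient.mk (AI F N)) (c • (X 0 ^ s 0 * X 1 ^ s 1)) =
      c • (Ideal.Quotient.mk (AI F N)) (X 0 ^ s 0 * X 1 ^ s 1) := rfl
    rw [this]
    exact Submodule.smul_mem _ _ (Submodule.subset_span ⟨(s 0, s 1), rfl⟩)
  | add p q hp hq => 
    rw [map_add]
    exact Submodule.add_mem _ (hp trivial) (hq trivial)

lemma AI_span' (N : ℕ) :
    Submodule.span F (Set.range fun s : Fin N × Fin N =>
      Ideal.Quotient.mk (AI F N) (X 0 ^ (s.1 : ℕ) * X 1 ^ (s.2 : ℕ))) = ⊤ := by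
  rw [eq_top_iff, ← AI_span (F := F) N, Submodule.span_le]
  rintro _ ⟨⟨i, j⟩, rfl⟩
  by_cases hi : i < N
  · by_cases hj : j < N
    · exact Submodule.subset_span ⟨(⟨i, hi⟩, ⟨j, hj⟩), rfl⟩
    · have : Ideal.Quotient.mk (AI F N) (X 0 ^ i * X 1 ^ j) = 0 := by
        rw [Ideal.Quotient.eq_zero_iff_mem]
        apply Ideal.mul_mem_left
        obtain ⟨c, rfl⟩ := Nat.exists_eq_add_of_le (not_lt.1 hj)
        rw [pow_add]
        exact Ideal.mul_mem_right _ _ (Ideal.subset_span (by simp))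
      simp only [SetLike.mem_coe, this, Submodule.zero_mem]
  · have : Ideal.Quotient.mk (AI F N) (X 0 ^ i * X 1 ^ j) = 0 := by
      rw [Ideal.Quotient.eq_zero_iff_mem]
      apply Ideal.mul_mem_right
      obtain ⟨c, rfl⟩ := Nat.exists_eq_add_of_le (not_lt.1 hi)
      rw [pow_add]
      exact Ideal.mul_mem_right _ _ (Ideal.subset_span (by simp))
    simp only [SetLike.mem_coe, this, Submodule.zero_mem]

instance AI_finite (N : ℕ) : Module.Finite F (MvPolynomial (Fin 2) F ⧸ AI F N) :=
  ⟨⟨(Set.finite_range fun s : Fin N × Fin N =>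
      Ideal.Quotient.mk (AI F N) (X 0 ^ (s.1 : ℕ) * X 1 ^ (s.2 : ℕ))).toFinset, by
      rw [Set.Finite.coe_toFinset, AI_span']⟩⟩

noncomputable def ev (i j : ℕ) : Fin 2 →₀ ℕ := Finsupp.single 0 i + Finsupp.single 1 j

lemma ev_zero (i j : ℕ) : ev i j 0 = i := by simp [ev]
lemma ev_one (i j : ℕ) : ev i j 1 = j := by simp [ev]

lemma ev_inj {i j k l : ℕ} (h : ev i j = ev k l) : i = k ∧ j = l :=
  ⟨by rw [← ev_zero i j, h, ev_zero], by rw [← ev_one i j, h, ev_one]⟩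

lemma ev_monomial (i j : ℕ) : (X 0 ^ i * X 1 ^ j : MvPolynomial (Fin 2) F) = monomial (ev i j) 1 := by
  rw [monomial_two, ev_zero, ev_one, one_smul]

lemma AI_coeff {N : ℕ} {f : MvPolynomial (Fin 2) F} (hf : f ∈ AI F N) {i j : ℕ} (hi : i < N)
    (hj : j < N) : f.coeff (ev i j) = 0 := by
  have h : AI F N = Ideal.span (Set.image (fun s => monomial s (1 : F)) {ev N 0, ev 0 N}) := by
    rw [AI, Set.image_pair, ← ev_monomial, ← ev_monomial]; simp
  rw [h, mem_ideal_span_monomial_image] at hf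
  by_contra hne
  obtain ⟨s, hs, hle⟩ := hf _ (mem_support_iff.2 hne)
  rcases hs with rfl | rfl
  · have := hle 0; rw [ev_zero, ev_zero] at this; omega
  · have := hle 1; rw [ev_one, ev_one] at this; omega

lemma AI_finrank (N : ℕ) : Module.finrank F (MvPolynomial (Fin 2) F ⧸ AI F N) = N * N := by
  have hli : LinearIndependent F (fun s : Fin N × Fin N =>
      Ideal.Quotient.mk (AI F N) (X 0 ^ (s.1 : ℕ) * X 1 ^ (s.2 : ℕ))) := by
    rw [Fintype.linearIndependent_iff]
    intro g hg s
    have h1 : Ideal.Quotient.mk (AI F N) (∑ s : Fin N × Fin N, g s • (X 0 ^ (s.1 : ℕ) * X 1 ^ (s.2 : ℕ))) = 0 := by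
      rw [map_sum]; exact hg
    rw [Ideal.Quotient.eq_zero_iff_mem] at h1
    have h2 := AI_coeff h1 s.1.2 s.2.2
    rw [coeff_sum, Finset.sum_eq_single s] at h2
    · rw [ev_monomial, coeff_smul, coeff_monomial, if_pos rfl] at h2
      simpa using h2
    · intro b _ hb
      rw [ev_monomial, coeff_smul, coeff_monomial, if_neg, smul_zero]
      intro h
      obtain ⟨h3, h4⟩ := ev_inj h
      exact hb (Prod.ext (Fin.ext h3) (Fin.ext h4))
    · simp
  have := Module.finrank_eq_card_basis (Module.Basis.mk hli (AI_span' N).ge)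
  simpa using this

/-- image of the quartic form -/
noncomputable def ta (F : Type) [Field F] (N : ℕ) : MvPolynomial (Fin 2) F ⧸ AI F N :=
  Ideal.Quotient.mk _ (TT F)

/-- rank of the power of the quartic form -/
noncomputable def rr (F : Type) [Field F] (k t : ℕ) : ℕ :=
  Module.finrank F ((Ideal.span {ta F (4 * k) ^ t}).restrictScalars F)

lemma rr_zero (k : ℕ) : rr F k 0 = 16 * k ^ 2 := by
  unfold rr
  rw [pow_zero, Ideal.span_singleton_one, Submodule.restrictScalars_top, finrank_top, AI_finrank]
  ring

lemma ta_pow_zero {k t : ℕ} (h : 2 * k ≤ t) : ta F (4 * k) ^ t = 0 := by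
  rw [ta, ← map_pow, Ideal.Quotient.eq_zero_iff_mem, TT]
  rcases Nat.eq_zero_or_pos k with rfl | hk
  · have : AI F (4 * 0) = ⊤ := by
      rw [Ideal.eq_top_iff_one]; exact Ideal.subset_span (by simp)
    rw [this]; trivial
  apply Ideal.add_pow_mem_of_pow_mem_of_le (m := k) (n := k)
  · rw [← pow_mul]; exact Ideal.subset_span (by simp)
  · rw [← pow_mul]; exact Ideal.subset_span (by simp)
  · omega

lemma rr_large {k t : ℕ} (h : 2 * k ≤ t) : rr F k t = 0 := by
  unfold rr
  rw [ta_pow_zero h]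
  simp

lemma neg_one_aux {R : Type*} [CommRing R] (t : ℕ) : (-1 : R) ^ t * (-1) ^ t = 1 := by
  rw [← mul_pow]; simp

lemma gap_mem (k t : ℕ) : ∃ ν : ℕ,
    ((4 * ν : ℕ) : ℤ) = 2 * (2 * k - t) + (ga F k (t + 1) : ℤ) ^ 2 - (ga F k t : ℤ) ^ 2 - 1 ∧
    ∃ b, ta F (4 * k) ^ t * Ideal.Quotient.mk _ (X 0 ^ (4 * ν)) = ta F (4 * k) ^ (t + 1) * b := by
  obtain ⟨d, g, c, a, hS, hc, hd, hg, hgap⟩ := gap_step (F := F) ![k, k, t] 2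
  have e : ![k, k, t] + Pi.single 2 1 = ![k, k, t + 1] := by
    funext j; fin_cases j <;> simp
  rw [e] at hgap
  change t ≤ d at hd
  refine ⟨d - t, ?_, ?_⟩
  · simp only [Fin.sum_univ_three, Matrix.cons_val_zero, Matrix.cons_val_one, Matrix.cons_val] at hgap
    obtain ⟨ν, rfl⟩ := Nat.exists_eq_add_of_le hd
    rw [Nat.add_sub_cancel_left]
    rcases hgap with ⟨h1, h2⟩ | ⟨h1, h2⟩
    · change ga F k (t + 1) = ga F k t + 1 at h1
      change _ = _ + ga F k t at h2
      rw [h1]; push_cast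
      have : (2 * (t + ν) : ℤ) = k + k + t + ga F k t := by exact_mod_cast h2
      linear_combination 2 * this
    · change ga F k (t + 1) + 1 = ga F k t at h1
      change _ + ga F k t = _ at h2
      rw [← h1] at h2 ⊢; push_cast
      have : (2 * (t + ν) : ℤ) + (ga F k (t + 1) + 1) = k + k + t := by exact_mod_cast h2
      linear_combination 2 * this
  · have h0 := hS.own 0
    have h1 := hS.own 1
    have hs := hS.sum
    simp only [Pi.zero_apply, zero_add, Matrix.cons_val_zero, Matrix.cons_val_one, lf_zero, lf_one] at h0 h1
    obtain ⟨u, hu⟩ := h0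
    obtain ⟨v, hv⟩ := h1
    change g 2 = lf F 2 ^ t * (C c * X 0 ^ (d - t) + lf F 2 * a) at hg
    rw [hu, hv, hg, lf_two] at hs
    have hs2 := congrArg (fun f => Ideal.Quotient.mk (AI F (4 * k)) (expand 4 f)) hs
    simp only [map_add, map_mul, map_pow, map_neg, expand_X, expand_C, map_zero] at hs2
    have z0 : (Ideal.Quotient.mk (AI F (4 * k)) (X 0) ^ 4) ^ k = 0 := by
      rw [← pow_mul, ← map_pow, Ideal.Quotient.eq_zero_iff_mem]; exact Ideal.subset_span (by simp)
    have z1 : (Ideal.Quotient.mk (AI F (4 * k)) (X 1) ^ 4) ^ k = 0 := by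
      rw [← pow_mul, ← map_pow, Ideal.Quotient.eq_zero_iff_mem]; exact Ideal.subset_span (by simp)
    have et : (Ideal.Quotient.mk (AI F (4 * k)) (X 0) ^ 4 + Ideal.Quotient.mk (AI F (4 * k)) (X 1) ^ 4) = ta F (4 * k) := by
      simp [ta, TT]
    rw [z0, z1, et] at hs2
    refine ⟨Ideal.Quotient.mk _ (C c⁻¹) * Ideal.Quotient.mk _ (expand 4 a), ?_⟩
    have hcc : Ideal.Quotient.mk (AI F (4 * k)) (C c⁻¹) * Ideal.Quotient.mk (AI F (4 * k)) (C c) = 1 := by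
      rw [← map_mul, ← C_mul, inv_mul_cancel₀ hc]; simp
    have hneg : (-ta F (4 * k)) ^ t = (-1) ^ t * ta F (4 * k) ^ t := neg_pow (R := MvPolynomial (Fin 2) F ⧸ AI F (4 * k)) _ _
    have hsg : ((-1 : MvPolynomial (Fin 2) F ⧸ AI F (4 * k)) ^ t) * (-1) ^ t = 1 := neg_one_aux _
    rw [hneg] at hs2
    rw [map_pow, pow_mul]
    set τ := ta F (4 * k)
    set m1 := ((-1 : MvPolynomial (Fin 2) F ⧸ AI F (4 * k)) ^ t)
    set cc := Ideal.Quotient.mk (AI F (4 * k)) (C c)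
    set ci := Ideal.Quotient.mk (AI F (4 * k)) (C c⁻¹)
    set x := (Ideal.Quotient.mk (AI F (4 * k)) (X 0) ^ 4) ^ (d - t)
    set a' := Ideal.Quotient.mk (AI F (4 * k)) (expand 4 a)
    rw [pow_succ]
    linear_combination m1 * ci * hs2 + (τ ^ t * τ * ci * a' - τ ^ t * ci * cc * x) * hsg - τ ^ t * x * hcc

lemma rr_step (k t ν : ℕ) (h : ∃ b, ta F (4 * k) ^ t * Ideal.Quotient.mk _ (X 0 ^ (4 * ν)) = ta F (4 * k) ^ (t + 1) * b) :
    rr F k t ≤ rr F k (t + 1) + 16 * ν := by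
  classical
  obtain ⟨b, hb⟩ := h
  let e : Fin (4 * ν) × Fin 4 → MvPolynomial (Fin 2) F ⧸ AI F (4 * k) := fun s =>
    ta F (4 * k) ^ t * Ideal.Quotient.mk _ (X 0 ^ (s.1 : ℕ) * X 1 ^ (s.2 : ℕ))
  let R := (Ideal.span {ta F (4 * k) ^ (t + 1)}).restrictScalars F
  let E := Submodule.span F (Set.range e)
  have hR : ∀ y, ta F (4 * k) ^ (t + 1) * y ∈ R := fun y =>
    Ideal.mul_mem_right _ _ (Ideal.subset_span rfl)
  have key : ∀ j i : ℕ, ta F (4 * k) ^ t * Ideal.Quotient.mk _ (X 0 ^ i * X 1 ^ j) ∈ R ⊔ E := by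
    intro j
    induction j using Nat.strong_induction_on with
    | _ j ih =>
      intro i
      by_cases hi : 4 * ν ≤ i
      · apply Submodule.mem_sup_left
        obtain ⟨m, rfl⟩ := Nat.exists_eq_add_of_le hi
        rw [pow_add, mul_assoc, map_mul, ← mul_assoc, hb, mul_assoc]
        exact hR _
      by_cases hj : 4 ≤ j
      · obtain ⟨m, rfl⟩ := Nat.exists_eq_add_of_le hj
        have h1 := ih m (by omega) (i + 4)
        have h2 : ta F (4 * k) ^ t * Ideal.Quotient.mk _ (X 0 ^ i * X 1 ^ (4 + m)) =
            ta F (4 * k) ^ (t + 1) * Ideal.Quotient.mk _ (X 0 ^ i * X 1 ^ m) -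
            ta F (4 * k) ^ t * Ideal.Quotient.mk _ (X 0 ^ (i + 4) * X 1 ^ m) := by
          have : ta F (4 * k) = Ideal.Quotient.mk _ (X 0) ^ 4 + Ideal.Quotient.mk _ (X 1) ^ 4 := by
            simp [ta, TT]
          rw [pow_succ (ta F (4 * k)) t]
          simp only [map_mul, map_pow]
          nth_rewrite 3 [this]
          ring
        rw [h2]
        exact Submodule.sub_mem _ (Submodule.mem_sup_left (hR _)) h1
      · apply Submodule.mem_sup_right
        exact Submodule.subset_span ⟨(⟨i, by omega⟩, ⟨j, by omega⟩), rfl⟩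
  have hle : (Ideal.span {ta F (4 * k) ^ t}).restrictScalars F ≤ R ⊔ E := by
    intro y hy
    rw [Submodule.restrictScalars_mem, Ideal.mem_span_singleton] at hy
    obtain ⟨z, rfl⟩ := hy
    have hz : z ∈ Submodule.span F (Set.range fun s : ℕ × ℕ =>
      Ideal.Quotient.mk (AI F (4 * k)) (X 0 ^ s.1 * X 1 ^ s.2)) := by rw [AI_span]; trivial
    induction hz using Submodule.span_induction with
    | mem x hx => obtain ⟨s, rfl⟩ := hx; exact key _ _
    | zero => rw [mul_zero]; exact Submodule.zero_mem _
    | add x y _ _ hx hy => rw [mul_add]; exact Submodule.add_mem _ hx hy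
    | smul a x _ hx => rw [mul_smul_comm]; exact Submodule.smul_mem _ _ hx
  calc rr F k t ≤ Module.finrank F ↥(R ⊔ E) := Submodule.finrank_mono hle
    _ ≤ Module.finrank F R + Module.finrank F E := Submodule.finrank_add_le_finrank_add_finrank _ _
    _ ≤ rr F k (t + 1) + 16 * ν := by
      gcongr
      · exact le_rfl
      · refine (finrank_range_le_card e).trans ?_
        simp; omega

/-- the numbers `ν` -/
noncomputable def nu (F : Type) [Field F] (k t : ℕ) : ℕ := (gap_mem (F := F) k t).choose

lemma nu_eq (k t : ℕ) : (4 * nu F k t : ℤ) =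
    2 * (2 * k - t) + (ga F k (t + 1) : ℤ) ^ 2 - (ga F k t : ℤ) ^ 2 - 1 := by
  have := (gap_mem (F := F) k t).choose_spec.1
  rw [← this]; push_cast; rfl

lemma sum_nu_aux (k t : ℕ) : 4 * ∑ s ∈ Finset.range t, (nu F k s : ℤ) = 4 * k * t - t ^ 2 + (ga F k t : ℤ) ^ 2 := by
  induction t with
  | zero => simp [ga_zero]
  | succ t ih => rw [Finset.sum_range_succ, mul_add, ih, nu_eq]; push_cast; ring

lemma sum_nu (k : ℕ) : ∑ s ∈ Finset.range (2 * k), nu F k s = k ^ 2 := by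
  have := sum_nu_aux (F := F) k (2 * k)
  rw [ga_large le_rfl] at this
  have h : 4 * ∑ s ∈ Finset.range (2 * k), (nu F k s : ℤ) = 4 * k ^ 2 := by
    rw [this]; push_cast; simp; ring
  have h2 : 4 * ∑ s ∈ Finset.range (2 * k), nu F k s = 4 * k ^ 2 := by exact_mod_cast h
  omega

lemma rr_nu (k t : ℕ) (ht : t ≤ 2 * k) : rr F k t + 16 * ∑ s ∈ Finset.range t, nu F k s = 16 * k ^ 2 := by
  have hst : ∀ t, rr F k t ≤ rr F k (t + 1) + 16 * nu F k t := fun t =>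
    rr_step k t _ (gap_mem (F := F) k t).choose_spec.2
  have h1 : ∀ t, 16 * k ^ 2 ≤ rr F k t + 16 * ∑ s ∈ Finset.range t, nu F k s := by
    intro t
    induction t with
    | zero => simp [rr_zero]
    | succ t ih => rw [Finset.sum_range_succ]; have := hst t; omega
  have h2 : ∀ m, rr F k t + 16 * ∑ s ∈ Finset.range t, nu F k s ≤
      rr F k (t + m) + 16 * ∑ s ∈ Finset.range (t + m), nu F k s := by
    intro m
    induction m with
    | zero => simp
    | succ m ih => rw [← add_assoc, Finset.sum_range_succ]; have := hst (t + m); omega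
  have h3 := h2 (2 * k - t)
  rw [Nat.add_sub_cancel' ht, rr_large le_rfl, sum_nu] at h3
  have := h1 t
  omega

/-- colength of powers of the quartic form -/
noncomputable def DD (F : Type) [Field F] (k t : ℕ) : ℕ :=
  Module.finrank F ((MvPolynomial (Fin 2) F ⧸ AI F (4 * k)) ⧸ Ideal.span {ta F (4 * k) ^ t})

lemma DD_rr (k t : ℕ) : DD F k t + rr F k t = 16 * k ^ 2 := by
  have := Submodule.finrank_quotient_add_finrank ((Ideal.span {ta F (4 * k) ^ t}).restrictScalars F)
  rw [AI_finrank] at this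
  rw [show 16 * k ^ 2 = 4 * k * (4 * k) by ring, ← this]
  rfl

lemma DD_eq (k t : ℕ) (ht : t ≤ 2 * k) : DD F k t = 16 * ∑ s ∈ Finset.range t, nu F k s := by
  have := DD_rr (F := F) k t
  have := rr_nu (F := F) k t ht
  omega

lemma DD_large (k t : ℕ) (ht : 2 * k ≤ t) : DD F k t = 16 * k ^ 2 := by
  have := DD_rr (F := F) k t
  have := rr_large (F := F) ht
  omega

lemma sum_nu_sq_aux (k n : ℕ) (hn : n ≤ 2 * k) :
    4 * ∑ t ∈ Finset.range n, (nu F k t : ℝ) ^ 2 = 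
      ∑ t ∈ Finset.range n, (((2 * k : ℝ) - t) ^ 2 - (2 * k - t)) + (2 * k - n) * (ga F k n : ℝ) ^ 2
       + 2 * ∑ t ∈ Finset.range n, (ga F k t : ℝ) ^ 2 + (ga F k n : ℝ) ^ 2 := by
  induction n with
  | zero => simp [ga_zero]
  | succ n ih =>
    specialize ih (by omega)
    rw [Finset.sum_range_succ, mul_add, ih, Finset.sum_range_succ, Finset.sum_range_succ]
    have h : (4 * nu F k n : ℝ) =
      2 * (2 * k - n) + (ga F k (n + 1) : ℝ) ^ 2 - (ga F k n : ℝ) ^ 2 - 1 := by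
      exact_mod_cast nu_eq (F := F) k n
    have h' : (nu F k n : ℝ) = (2 * (2 * k - n) + (ga F k (n + 1) : ℝ) ^ 2 - (ga F k n : ℝ) ^ 2 - 1) / 4 := by
      linarith
    rw [h']
    push_cast
    rcases ga_lip (F := F) k n with e | e
    · rw [e]; push_cast; ring
    · rw [← e]; push_cast; ring

lemma sum_desc (n : ℕ) : ∑ t ∈ Finset.range n, (((n : ℝ) - t) ^ 2 - (n - t)) = ((n : ℝ) ^ 3 - n) / 3 := by
  have : ∀ m : ℕ, ∑ t ∈ Finset.range m, (((n : ℝ) - t) ^ 2 - (n - t)) =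
     ((n : ℝ) ^ 3 - n) / 3 - (((n : ℝ) - m) ^ 3 - (n - m)) / 3 := by
    intro m
    induction m with
    | zero => simp
    | succ m ih => rw [Finset.sum_range_succ, ih]; push_cast; ring
  rw [this]; ring

lemma sum_nu_sq (k : ℕ) : 4 * ∑ t ∈ Finset.range (2 * k), (nu F k t : ℝ) ^ 2 =
    (8 * (k : ℝ) ^ 3 - 2 * k) / 3 + 2 * SS F k := by
  rw [sum_nu_sq_aux k (2 * k) le_rfl, ga_large le_rfl]
  have := sum_desc (2 * k)
  push_cast at this ⊢
  rw [this, SS]; push_cast; simp; ring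
end dims
end HKaux


namespace HKaux

section struct
open TensorProduct
variable {F : Type} [Field F]

/-- the quotient ring viewed as algebra over `F[T]` with `T` acting by `θ` -/
def VV (F : Type) [Field F] (k : ℕ) (_θ : MvPolynomial (Fin 2) F) : Type :=
  MvPolynomial (Fin 2) F ⧸ AI F (4 * k)

variable {k : ℕ} {θ : MvPolynomial (Fin 2) F}

noncomputable instance : CommRing (VV F k θ) :=
  inferInstanceAs (CommRing (MvPolynomial (Fin 2) F ⧸ AI F (4 * k)))

noncomputable instance : Algebra F (VV F k θ) :=
  inferInstanceAs (Algebra F (MvPolynomial (Fin 2) F ⧸ AI F (4 * k)))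

instance : Module.Finite F (VV F k θ) :=
  inferInstanceAs (Module.Finite F (MvPolynomial (Fin 2) F ⧸ AI F (4 * k)))

/-- quotient map -/
noncomputable def vmk (k : ℕ) (θ : MvPolynomial (Fin 2) F) : MvPolynomial (Fin 2) F →ₐ[F] VV F k θ :=
  Ideal.Quotient.mkₐ F (AI F (4 * k))

lemma vmk_surj : Function.Surjective (vmk k θ) := Ideal.Quotient.mk_surjective

noncomputable instance VV_alg : Algebra (Polynomial F) (VV F k θ) :=
  (Polynomial.aeval (R := F) (vmk k θ θ)).toRingHom.toAlgebra

lemma VV_map (f : Polynomial F) : algebraMap (Polynomial F) (VV F k θ) f =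
    Polynomial.aeval (vmk k θ θ) f := rfl

instance : IsScalarTower F (Polynomial F) (VV F k θ) :=
  IsScalarTower.of_algebraMap_eq' (by
    ext c
    rw [RingHom.comp_apply, VV_map]
    simp)

/-- lift -/
noncomputable def vlift {B : Type} [CommRing B] [Algebra F B] (k : ℕ) (θ : MvPolynomial (Fin 2) F)
    (b : Fin 2 → B) (hb : ∀ i, b i ^ (4 * k) = 0) :
    VV F k θ →ₐ[F] B :=
  Ideal.Quotient.liftₐ (AI F (4 * k)) (aeval b) (by
    intro a ha
    have : AI F (4 * k) ≤ RingHom.ker (aeval b : MvPolynomial (Fin 2) F →ₐ[F] B) := by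
      rw [AI, Ideal.span_le]
      rintro _ (rfl | rfl)
      · simp [RingHom.mem_ker, hb]
      · simp [RingHom.mem_ker, hb]
    exact this ha)

lemma vlift_mk {B : Type} [CommRing B] [Algebra F B] (b : Fin 2 → B) (hb : ∀ i, b i ^ (4 * k) = 0)
   (f : MvPolynomial (Fin 2) F) : vlift k θ b hb (vmk k θ f) = aeval b f := rfl

lemma vmk_pow (i : Fin 2) : vmk k θ (X i) ^ (4 * k) = 0 := by
  rw [← map_pow]
  apply Ideal.Quotient.eq_zero_iff_mem.2
  fin_cases i <;> exact Ideal.subset_span (by simp)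

lemma aeval_TT {B : Type} [CommRing B] [Algebra F B] (b : Fin 2 → B) :
    aeval b (TT F) = b 0 ^ 4 + b 1 ^ 4 := by simp [TT]

lemma vmk_TT : vmk k θ (TT F) = vmk k θ (X 0) ^ 4 + vmk k θ (X 1) ^ 4 := by
  rw [TT, map_add, map_pow, map_pow]

lemma hk_tensor (k : ℕ) : hkColength F 4 ![4, 4, 4, 4] (4 * k) =
    Module.finrank F (VV F k (TT F) ⊗[Polynomial F] VV F k (-TT F)) := by
  unfold hkColength
  set J : Ideal (MvPolynomial (Fin 4) F) := Ideal.span (insert (∑ i : Fin 4, (X i : MvPolynomial (Fin 4) F) ^ (![4, 4, 4, 4] : Fin 4 → ℕ) i)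
      (Set.range fun i : Fin 4 => (X i : MvPolynomial (Fin 4) F) ^ (4 * k))) with hJ
  let Q := MvPolynomial (Fin 4) F ⧸ J
  let q : MvPolynomial (Fin 4) F →ₐ[F] Q := Ideal.Quotient.mkₐ F J
  have hq0 : ∀ i, q (X i) ^ (4 * k) = 0 := by
    intro i
    rw [← map_pow]
    exact Ideal.Quotient.eq_zero_iff_mem.2 (Ideal.subset_span (Or.inr ⟨i, rfl⟩))
  have hqs : q (X 0) ^ 4 + q (X 1) ^ 4 = - (q (X 2) ^ 4 + q (X 3) ^ 4) := by
    have : q (∑ i : Fin 4, (X i : MvPolynomial (Fin 4) F) ^ (![4, 4, 4, 4] : Fin 4 → ℕ) i) = 0 :=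
      Ideal.Quotient.eq_zero_iff_mem.2 (Ideal.subset_span (Or.inl rfl))
    simp [Fin.sum_univ_four] at this
    linear_combination this
  let gV : VV F k (TT F) →ₐ[F] Q := vlift k (TT F) ![q (X 0), q (X 1)] (by
    intro i; fin_cases i <;> exact hq0 _)
  let gW : VV F k (-TT F) →ₐ[F] Q := vlift k (-TT F) ![q (X 2), q (X 3)] (by
    intro i; fin_cases i <;> exact hq0 _)
  let _ : Algebra (Polynomial F) Q := (Polynomial.aeval (R := F) (q (X 0) ^ 4 + q (X 1) ^ 4)).toRingHom.toAlgebra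
  have hQ : ∀ f, algebraMap (Polynomial F) Q f = Polynomial.aeval (q (X 0) ^ 4 + q (X 1) ^ 4) f := fun _ => rfl
  have hVc : ∀ f, gV (algebraMap (Polynomial F) _ f) = algebraMap (Polynomial F) Q f := by
    intro f
    rw [VV_map, hQ, ← Polynomial.aeval_algHom_apply]
    congr 2
    rw [vlift_mk, aeval_TT]; simp
  have hWc : ∀ f, gW (algebraMap (Polynomial F) _ f) = algebraMap (Polynomial F) Q f := by
    intro f
    rw [VV_map, hQ, ← Polynomial.aeval_algHom_apply, hqs]
    congr 2
    rw [vlift_mk, map_neg, aeval_TT]; simp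
  let gV' : VV F k (TT F) →ₐ[Polynomial F] Q := { gV with commutes' := hVc }
  let gW' : VV F k (-TT F) →ₐ[Polynomial F] Q := { gW with commutes' := hWc }
  let g := Algebra.TensorProduct.productMap gV' gW'
  let Z := VV F k (TT F) ⊗[Polynomial F] VV F k (-TT F)
  let iV : VV F k (TT F) →ₐ[F] Z := Algebra.TensorProduct.includeLeft
  let iW : VV F k (-TT F) →ₐ[F] Z :=
    (Algebra.TensorProduct.includeRight : VV F k (-TT F) →ₐ[Polynomial F] Z).restrictScalars F
  let f0 : MvPolynomial (Fin 4) F →ₐ[F] Z :=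
    aeval ![iV (vmk _ _ (X 0)), iV (vmk _ _ (X 1)), iW (vmk _ _ (X 0)), iW (vmk _ _ (X 1))]
  have hf0 : ∀ a ∈ J, f0 a = 0 := by
    intro a ha
    have : J ≤ RingHom.ker f0 := by
      rw [hJ, Ideal.span_le]
      rintro _ (rfl | ⟨i, rfl⟩)
      · have h1 : iV (vmk _ _ (TT F)) = algebraMap (Polynomial F) Z Polynomial.X := by
          have := (Algebra.TensorProduct.includeLeft : VV F k (TT F) →ₐ[Polynomial F] Z).commutes Polynomial.X
          rw [VV_map, Polynomial.aeval_X] at this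
          exact this
        have h2 : iW (vmk _ _ (-TT F)) = algebraMap (Polynomial F) Z Polynomial.X := by
          have := (Algebra.TensorProduct.includeRight : VV F k (-TT F) →ₐ[Polynomial F] Z).commutes Polynomial.X
          rw [VV_map, Polynomial.aeval_X] at this
          exact this
        rw [← h2] at h1
        rw [map_neg, map_neg, vmk_TT, vmk_TT] at h1
        simp only [map_add, map_pow] at h1
        rw [SetLike.mem_coe, RingHom.mem_ker]
        simp [Fin.sum_univ_four, f0]
        linear_combination h1
      · rw [SetLike.mem_coe, RingHom.mem_ker, map_pow]
        fin_cases i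
        all_goals simp [f0]; rw [← map_pow, vmk_pow, map_zero]
    exact this ha
  let f : Q →ₐ[F] Z := Ideal.Quotient.liftₐ J f0 hf0
  have hfq : ∀ a, f (q a) = f0 a := fun _ => rfl
  have hgf : ∀ x, g (f x) = x := by
    have : ((g : Z →+* Q).comp (f : Q →+* Z)).comp (q : MvPolynomial (Fin 4) F →+* Q) = (q : MvPolynomial (Fin 4) F →+* Q) := by
      apply MvPolynomial.ringHom_ext
      · intro c
        have h1 : f (q (C c)) = iV (vmk _ _ (C c)) := by
          rw [hfq]
          have e1 : f0 (C c) = algebraMap F Z c := f0.commutes c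
          have e2 : iV (vmk _ _ (C c)) = algebraMap F Z c := by
            rw [show vmk k (TT F) (C c) = algebraMap F _ c from rfl]
            exact iV.commutes c
          rw [e1, e2]
        change g (f (q (C c))) = q (C c)
        rw [h1]
        change g (_ ⊗ₜ 1) = _
        simp only [g, Algebra.TensorProduct.productMap_apply_tmul, map_one, mul_one]
        change gV _ = _
        simp only [gV, vlift_mk, MvPolynomial.aeval_C]
        rfl
      · intro i
        change g (f (q (X i))) = q (X i)
        rw [hfq]
        have hV : ∀ a, g (iV a) = gV a := by
          intro a
          change g (_ ⊗ₜ 1) = _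
          simp only [g, Algebra.TensorProduct.productMap_apply_tmul, map_one, mul_one]
          rfl
        have hW : ∀ a, g (iW a) = gW a := by
          intro a
          change g (1 ⊗ₜ _) = _
          simp only [g, Algebra.TensorProduct.productMap_apply_tmul, map_one, one_mul]
          rfl
        fin_cases i
        · simp [f0, hV, gV, vlift_mk]
        · simp [f0, hV, gV, vlift_mk]
        · simp [f0, hW, gW, vlift_mk]
        · simp [f0, hW, gW, vlift_mk]
    intro x
    obtain ⟨a, rfl⟩ := Ideal.Quotient.mk_surjective x
    exact congrArg (fun h : MvPolynomial (Fin 4) F →+* Q => h a) this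
  have hfV : ∀ a, f (gV a) = iV a := by
    intro a
    obtain ⟨a, rfl⟩ := vmk_surj a
    have : (f.comp gV).comp (vmk k (TT F)) = iV.comp (vmk k (TT F)) := by
      apply MvPolynomial.algHom_ext
      intro i
      fin_cases i <;> simp [gV, vlift_mk, hfq, f0]
    exact congrArg (fun h : MvPolynomial (Fin 2) F →ₐ[F] Z => h a) this
  have hfW : ∀ a, f (gW a) = iW a := by
    intro a
    obtain ⟨a, rfl⟩ := vmk_surj a
    have : (f.comp gW).comp (vmk k (-TT F)) = iW.comp (vmk k (-TT F)) := by
      apply MvPolynomial.algHom_ext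
      intro i
      fin_cases i <;> simp [gW, vlift_mk, hfq, f0]
    exact congrArg (fun h : MvPolynomial (Fin 2) F →ₐ[F] Z => h a) this
  have hsurj : Function.Surjective f := by
    intro z
    induction z using TensorProduct.induction_on with
    | zero => exact ⟨0, map_zero _⟩
    | tmul a b =>
      refine ⟨gV a * gW b, ?_⟩
      rw [map_mul, hfV, hfW]
      change (a ⊗ₜ 1) * (1 ⊗ₜ b) = _
      rw [Algebra.TensorProduct.tmul_mul_tmul, mul_one, one_mul]
    | add x y hx hy =>
      obtain ⟨x, rfl⟩ := hx
      obtain ⟨y, rfl⟩ := hy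
      exact ⟨x + y, map_add _ _ _⟩
  have hinj : Function.Injective f := Function.LeftInverse.injective hgf
  exact (LinearEquiv.ofBijective f.toLinearMap ⟨hinj, hsurj⟩).finrank_eq

end struct
end HKaux


namespace HKaux

section mods
open TensorProduct
variable {F : Type} [Field F]

/-- ideal generated by a power of the variable -/
noncomputable def XI (F : Type) [Field F] (a : ℕ) : Ideal (Polynomial F) :=
  Submodule.span (Polynomial F) {(Polynomial.X : Polynomial F) ^ a}

lemma XI_finrank (a : ℕ) : Module.finrank F (Polynomial F ⧸ XI F a) = a := by
  have := finrank_quotient_span_eq_natDegree (K := F) (f := Polynomial.X ^ a)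
  rw [Polynomial.natDegree_X_pow] at this
  exact this

instance XI_finite (a : ℕ) : Module.Finite F (Polynomial F ⧸ XI F a) :=
  (Polynomial.monic_X_pow (R := F) a).finite_quotient

variable {V M : Type} [AddCommGroup V] [AddCommGroup M] [Module F V] [Module F M]
  [Module (Polynomial F) V] [Module (Polynomial F) M] [IsScalarTower F (Polynomial F) V]
  [IsScalarTower F (Polynomial F) M]

lemma quot_fin [Module.Finite F M] (N : Submodule (Polynomial F) M) : Module.Finite F (M ⧸ N) :=
  Module.Finite.of_surjective (N.mkQ.restrictScalars F) (by
    intro x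
    obtain ⟨y, rfl⟩ := N.mkQ_surjective x
    exact ⟨y, rfl⟩)

lemma tens_finrank [Module.Finite F M] {d : ℕ} {a : Fin d → ℕ}
    (e : V ≃ₗ[Polynomial F] DirectSum (Fin d) fun i => Polynomial F ⧸ XI F (a i)) :
    Module.finrank F (V ⊗[Polynomial F] M) =
      ∑ i, Module.finrank F (M ⧸ (XI F (a i) • ⊤ : Submodule (Polynomial F) M)) := by
  classical
  let e1 : V ⊗[Polynomial F] M ≃ₗ[Polynomial F] 
      (DirectSum (Fin d) fun i => Polynomial F ⧸ XI F (a i)) ⊗[Polynomial F] M :=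
    TensorProduct.congr e (LinearEquiv.refl _ _)
  let e2 := TensorProduct.directSumLeft (Polynomial F) (Polynomial F) (fun i => Polynomial F ⧸ XI F (a i)) M
  let e3 := DirectSum.linearEquivFunOnFintype (Polynomial F) (Fin d) (fun i => (Polynomial F ⧸ XI F (a i)) ⊗[Polynomial F] M)
  let e4 := LinearEquiv.piCongrRight (fun i => TensorProduct.quotTensorEquivQuotSMul M (XI F (a i)))
  obtain ⟨e5⟩ : Nonempty (V ⊗[Polynomial F] M ≃ₗ[Polynomial F]
      ((i : Fin d) → M ⧸ (XI F (a i) • ⊤ : Submodule (Polynomial F) M))) :=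
    ⟨e1.trans (e2.trans (e3.trans e4))⟩
  clear e1 e2 e3 e4
  have h : Module.finrank F (V ⊗[Polynomial F] M) = 
    Module.finrank F ((i : Fin d) → M ⧸ (XI F (a i) • ⊤ : Submodule (Polynomial F) M)) :=
    (e5.restrictScalars F).finrank_eq
  have hf : ∀ i, Module.Finite F (M ⧸ (XI F (a i) • ⊤ : Submodule (Polynomial F) M)) := fun i =>
    quot_fin _
  rw [h, Module.finrank_pi_fintype]

lemma quot_finrank (a : ℕ) : Module.finrank F (V ⊗[Polynomial F] (Polynomial F ⧸ XI F a)) =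
    Module.finrank F (V ⧸ (XI F a • ⊤ : Submodule (Polynomial F) V)) :=
  ((TensorProduct.tensorQuotEquivQuotSMul V (XI F a)).restrictScalars F).finrank_eq

lemma XI_smul_bot {a b : ℕ} (h : a ≤ b) : (XI F b • ⊤ : Submodule (Polynomial F) (Polynomial F ⧸ XI F a)) = ⊥ := by
  rw [eq_bot_iff, Submodule.smul_le]
  intro r hr n _
  obtain ⟨f, rfl⟩ := Ideal.Quotient.mk_surjective n
  have : r • Ideal.Quotient.mk (XI F a) f = Ideal.Quotient.mk (XI F a) (r * f) := rfl
  rw [this, Submodule.mem_bot, Ideal.Quotient.eq_zero_iff_mem]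
  apply Ideal.mul_mem_right
  obtain ⟨c, rfl⟩ := Ideal.mem_span_singleton.1 hr
  exact Ideal.mul_mem_right _ _ (Ideal.mem_span_singleton.2 (pow_dvd_pow _ h))

lemma XI_quot_min (a t : ℕ) : Module.finrank F ((Polynomial F ⧸ XI F t) ⧸ (XI F a • ⊤ : Submodule (Polynomial F) (Polynomial F ⧸ XI F t))) = min a t := by
  have key : ∀ a t : ℕ, t ≤ a → Module.finrank F ((Polynomial F ⧸ XI F t) ⧸ (XI F a • ⊤ : Submodule (Polynomial F) (Polynomial F ⧸ XI F t))) = t := by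
    intro a t h
    rw [((Submodule.quotEquivOfEqBot _ (XI_smul_bot h)).restrictScalars F).finrank_eq, XI_finrank]
  rcases le_total t a with h | h
  · rw [key a t h, min_eq_right h]
  · rw [← quot_finrank, min_eq_left h]
    refine Eq.trans ?_ (key t a h)
    rw [← quot_finrank]
    exact ((TensorProduct.comm (Polynomial F) (Polynomial F ⧸ XI F t) (Polynomial F ⧸ XI F a)).restrictScalars F).finrank_eq

end mods

section struct2
open TensorProduct
variable {F : Type} [Field F] {k : ℕ} {θ : MvPolynomial (Fin 2) F}

lemma VV_quot (hθ : θ = TT F ∨ θ = - TT F) (a : ℕ) :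
    Module.finrank F (VV F k θ ⧸ (XI F a • ⊤ : Submodule (Polynomial F) (VV F k θ))) = DD F k a := by
  have h1 := (Submodule.Quotient.restrictScalarsEquiv F (XI F a • ⊤ : Submodule (Polynomial F) (VV F k θ))).finrank_eq
  rw [← h1]
  let N : Submodule F (VV F k θ) := (Ideal.span {ta F (4 * k) ^ a}).restrictScalars F
  have h2 : (XI F a • ⊤ : Submodule (Polynomial F) (VV F k θ)).restrictScalars F = N := by
    have hs : ∀ (c : Polynomial F) (x : VV F k θ), c • x = Polynomial.aeval (vmk k θ θ) c * x := fun c x =>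
      Algebra.smul_def c x
    have hX : Associated ((vmk k θ θ) ^ a) (vmk k θ (TT F) ^ a) := by
      apply Associated.pow_pow
      rcases hθ with rfl | rfl
      · rfl
      · rw [map_neg]; exact (Associated.refl _).neg_left
    ext x
    have hN : x ∈ N ↔ vmk k θ (TT F) ^ a ∣ x := Ideal.mem_span_singleton
    rw [hN, ← hX.dvd_iff_dvd_left, Submodule.restrictScalars_mem, XI,
      Submodule.ideal_span_singleton_smul, Submodule.mem_smul_pointwise_iff_exists]
    constructor
    · rintro ⟨b, _, rfl⟩
      rw [hs]; simp
    · rintro ⟨b, rfl⟩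
      refine ⟨b, trivial, ?_⟩
      rw [hs]; simp
  rw [h2]
  exact ((Submodule.Quotient.restrictScalarsEquiv F (Ideal.span {ta F (4 * k) ^ a}))).finrank_eq

lemma hk_four (k : ℕ) : hkColength F 4 ![4, 4, 4, 4] (4 * k) =
    256 * ∑ t ∈ Finset.range (2 * k), nu F k t ^ 2 := by
  classical
  have hT : Module.IsTorsion' (VV F k (TT F)) ↥(Submonoid.powers (Polynomial.X : Polynomial F)) := by
    intro x
    refine ⟨⟨Polynomial.X ^ (2 * k), 2 * k, rfl⟩, ?_⟩
    change (Polynomial.X ^ (2 * k) : Polynomial F) • x = 0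
    rw [Algebra.smul_def, VV_map, map_pow, Polynomial.aeval_X]
    have : vmk k (TT F) (TT F) ^ (2 * k) = 0 := ta_pow_zero le_rfl
    rw [this, zero_mul]
  have : Module.Finite (Polynomial F) (VV F k (TT F)) := Module.Finite.of_restrictScalars_finite F _ _
  obtain ⟨d, a, ⟨e⟩⟩ := Module.torsion_by_prime_power_decomposition Polynomial.irreducible_X hT
  have hD : ∀ t, DD F k t = ∑ i, min (a i) t := by
    intro t
    rw [← VV_quot (F := F) (θ := TT F) (Or.inl rfl), ← quot_finrank, tens_finrank e]
    exact Finset.sum_congr rfl fun i _ => XI_quot_min _ _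
  have hhk : hkColength F 4 ![4, 4, 4, 4] (4 * k) = ∑ i, DD F k (a i) := by
    rw [hk_tensor, tens_finrank e]
    exact Finset.sum_congr rfl fun i _ => VV_quot (Or.inr rfl) _
  have hcard : ∀ t, DD F k (t + 1) = DD F k t + ∑ i, if t < a i then 1 else 0 := by
    intro t
    rw [hD, hD, ← Finset.sum_add_distrib]
    refine Finset.sum_congr rfl fun i _ => ?_
    split_ifs <;> omega
  have hle : ∀ i, a i ≤ 2 * k := by
    intro i
    have h := hcard (2 * k)
    rw [DD_large _ _ le_rfl, DD_large _ _ (Nat.le_succ _)] at h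
    have h0 : ∑ i, (if 2 * k < a i then 1 else 0) = 0 := by omega
    rw [Finset.sum_eq_zero_iff] at h0
    have := h0 i (Finset.mem_univ _)
    by_contra hc
    rw [if_pos (by omega)] at this
    omega
  have hnu : ∀ t, t < 2 * k → ∑ i, (if t < a i then 1 else 0) = 16 * nu F k t := by
    intro t ht
    have h := hcard t
    rw [DD_eq _ _ ht.le, DD_eq _ _ ht, Finset.sum_range_succ] at h
    omega
  have hDa : ∀ i, DD F k (a i) = ∑ t ∈ Finset.range (2 * k), 16 * nu F k t * (if t < a i then 1 else 0) := by
    intro i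
    rw [DD_eq _ _ (hle i), Finset.mul_sum]
    simp only [mul_ite, mul_one, mul_zero]
    rw [← Finset.sum_filter]
    refine Finset.sum_congr ?_ fun _ _ => rfl
    ext t
    have := hle i
    simp only [Finset.mem_range, Finset.mem_filter]
    omega
  rw [hhk, Finset.sum_congr rfl fun i _ => hDa i, Finset.sum_comm, Finset.mul_sum]
  refine Finset.sum_congr rfl fun t ht => ?_
  rw [← Finset.mul_sum, hnu t (Finset.mem_range.1 ht)]
  ring

lemma hk_val (k : ℕ) : (hkColength F 4 ![4, 4, 4, 4] (4 * k) : ℝ) =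
    64 * ((8 * (k : ℝ) ^ 3 - 2 * k) / 3 + 2 * SS F k) := by
  rw [hk_four, ← sum_nu_sq]
  push_cast; ring

lemma hk_mono {q q' : ℕ} (h : q ≤ q')
    (hfin : Module.Finite F (MvPolynomial (Fin 4) F ⧸
    Ideal.span (insert (∑ i : Fin 4, (X i : MvPolynomial (Fin 4) F) ^ (![4, 4, 4, 4] : Fin 4 → ℕ) i)
      (Set.range fun i : Fin 4 => (X i : MvPolynomial (Fin 4) F) ^ q')))) :
    hkColength F 4 ![4, 4, 4, 4] q ≤ hkColength F 4 ![4, 4, 4, 4] q' := by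
  unfold hkColength
  have hle : Ideal.span (insert (∑ i : Fin 4, (X i : MvPolynomial (Fin 4) F) ^ (![4, 4, 4, 4] : Fin 4 → ℕ) i)
      (Set.range fun i : Fin 4 => (X i : MvPolynomial (Fin 4) F) ^ q')) ≤ 
      Ideal.span (insert (∑ i : Fin 4, (X i : MvPolynomial (Fin 4) F) ^ (![4, 4, 4, 4] : Fin 4 → ℕ) i)
      (Set.range fun i : Fin 4 => (X i : MvPolynomial (Fin 4) F) ^ q)) := by
    rw [Ideal.span_le]
    rintro _ (rfl | ⟨i, rfl⟩)
    · exact Ideal.subset_span (Or.inl rfl)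
    · obtain ⟨m, rfl⟩ := Nat.exists_eq_add_of_le h
      simp only [pow_add]
      exact Ideal.mul_mem_right _ _ (Ideal.subset_span (Or.inr ⟨i, rfl⟩))
  exact LinearMap.finrank_le_finrank_of_surjective (f := (Ideal.Quotient.factorₐ F hle).toLinearMap)
    (Ideal.Quotient.factor_surjective hle)

lemma hk_fin (q : ℕ) : Module.Finite F (MvPolynomial (Fin 4) F ⧸
    Ideal.span (insert (∑ i : Fin 4, (X i : MvPolynomial (Fin 4) F) ^ (![4, 4, 4, 4] : Fin 4 → ℕ) i)
      (Set.range fun i : Fin 4 => (X i : MvPolynomial (Fin 4) F) ^ q))) := by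
  set J := Ideal.span (insert (∑ i : Fin 4, (X i : MvPolynomial (Fin 4) F) ^ (![4, 4, 4, 4] : Fin 4 → ℕ) i)
      (Set.range fun i : Fin 4 => (X i : MvPolynomial (Fin 4) F) ^ q))
  let e : (Fin 4 → Fin q) → MvPolynomial (Fin 4) F ⧸ J := fun s =>
    Ideal.Quotient.mk J (∏ i, X i ^ (s i : ℕ))
  have hs : Submodule.span F (Set.range e) = ⊤ := by
    rw [eq_top_iff]
    intro x _
    obtain ⟨f, rfl⟩ := Ideal.Quotient.mk_surjective x
    induction f using MvPolynomial.induction_on' with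
    | monomial s c =>
      rw [monomial_eq, Finsupp.prod_fintype _ _ (by simp), ← MvPolynomial.smul_eq_C_mul]
      have : (Ideal.Quotient.mk J) (c • ∏ i, X i ^ s i) =
        c • (Ideal.Quotient.mk J) (∏ i, X i ^ s i) := rfl
      rw [this]
      apply Submodule.smul_mem
      by_cases h : ∀ i, s i < q
      · exact Submodule.subset_span ⟨fun i => ⟨s i, h i⟩, rfl⟩
      · push Not at h
        obtain ⟨i, hi⟩ := h
        have h0 : (Ideal.Quotient.mk J) (∏ i, X i ^ s i) = 0 := by
          rw [Ideal.Quotient.eq_zero_iff_mem]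
          refine Ideal.mem_of_dvd J (Finset.dvd_prod_of_mem _ (Finset.mem_univ i)) ?_
          obtain ⟨m, hm⟩ := Nat.exists_eq_add_of_le hi
          rw [hm, pow_add]
          exact Ideal.mul_mem_right _ _ (Ideal.subset_span (Or.inr ⟨i, rfl⟩))
        rw [h0]; exact Submodule.zero_mem _
    | add p q hp hq => 
      rw [map_add]
      exact Submodule.add_mem _ (hp trivial) (hq trivial)
  exact ⟨⟨(Set.finite_range e).toFinset, by rw [Set.Finite.coe_toFinset, hs]⟩⟩

end struct2
end HKaux


namespace HKaux

section final
variable {F : Type} [Field F]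

lemma hk_bound (k Q : ℕ) (a ε : ℝ) (hQ1 : 1 ≤ Q) (h1 : 4 * k ≤ Q + 1) (h2 : Q ≤ 4 * k + 1) (ha : 0 ≤ a)
    (h : |(SS F k : ℝ) - ε * (Q : ℝ) ^ 3| ≤ a * (Q : ℝ) ^ 2) :
    |(hkColength F 4 ![4, 4, 4, 4] Q : ℝ) - (8 / 3 + 128 * ε) * (Q : ℝ) ^ 3| ≤
      (128 * a + 40000) * (Q : ℝ) ^ 2 := by
  have r1 : (4 * k : ℝ) ≤ Q + 1 := by exact_mod_cast h1
  have r2 : (Q : ℝ) ≤ 4 * k + 1 := by exact_mod_cast h2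
  have r0 : (1 : ℝ) ≤ Q := by exact_mod_cast hQ1
  have rk : (0 : ℝ) ≤ k := Nat.cast_nonneg _
  have hQ2 : (Q : ℝ) ≤ (Q : ℝ) ^ 2 := by nlinarith
  have hQ2' : (1 : ℝ) ≤ (Q : ℝ) ^ 2 := by nlinarith
  rw [abs_le] at h ⊢
  obtain ⟨ha1, ha2⟩ := h
  have up : (hkColength F 4 ![4, 4, 4, 4] Q : ℝ) ≤ hkColength F 4 ![4, 4, 4, 4] (4 * (k + 1)) := by
    exact_mod_cast hk_mono (by omega) (hk_fin _)
  have lo : (hkColength F 4 ![4, 4, 4, 4] (4 * (k - 1)) : ℝ) ≤ hkColength F 4 ![4, 4, 4, 4] Q := by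
    exact_mod_cast hk_mono (by omega) (hk_fin _)
  rw [hk_val] at up lo
  have l1 := SS_lip (F := F) k
  rw [abs_le] at l1
  obtain ⟨_, l2⟩ := l1
  push_cast at up
  have k2 : ((k : ℝ) + 1) ^ 2 ≤ 9 / 4 * (Q : ℝ) ^ 2 := by
    have : (k : ℝ) + 1 ≤ 3 / 2 * Q := by linarith
    nlinarith
  have k3 : (4 * ((k : ℝ) + 1)) ^ 3 ≤ (Q + 5 : ℝ) ^ 3 := pow_le_pow_left₀ (by positivity) (by linarith) 3
  have k4 : (Q + 5 : ℝ) ^ 3 ≤ (Q : ℝ) ^ 3 + 215 * (Q : ℝ) ^ 2 := by nlinarith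
  constructor
  · rcases Nat.eq_zero_or_pos k with rfl | hk
    · have hQ : Q = 1 := by omega
      subst hQ
      simp [SS] at ha1 ha2 lo ⊢
      linarith
    · obtain ⟨m, rfl⟩ : ∃ m, k = m + 1 := ⟨k - 1, by omega⟩
      rw [Nat.add_sub_cancel] at lo
      have l3 := SS_lip (F := F) m
      rw [abs_le] at l3
      obtain ⟨_, l4⟩ := l3
      push_cast at *
      have m0 : (0 : ℝ) ≤ m := Nat.cast_nonneg _
      have m2 : ((m : ℝ) + 1) ^ 2 ≤ 9 / 4 * (Q : ℝ) ^ 2 := by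
        have : (m : ℝ) + 1 ≤ 3 / 2 * Q := by linarith
        nlinarith
      have m3 : (Q - 5 : ℝ) ^ 3 ≤ (4 * (m : ℝ)) ^ 3 :=
        (Odd.strictMono_pow (by decide : Odd 3)).monotone (by linarith)
      have m4 : (Q : ℝ) ^ 3 - 140 * (Q : ℝ) ^ 2 ≤ (Q - 5 : ℝ) ^ 3 := by nlinarith
      have m5 : (m : ℝ) ≤ (Q : ℝ) ^ 2 := by linarith
      nlinarith
  · nlinarith

lemma hk_tendsto (p : ℕ) (hp : 2 ≤ p) (a ε : ℝ) (ha : 0 ≤ a)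
    (h : ∀ n, ∃ k, (4 * k ≤ p ^ n + 1 ∧ p ^ n ≤ 4 * k + 1) ∧
      |(SS F k : ℝ) - ε * ((p : ℝ) ^ n) ^ 3| ≤ a * ((p : ℝ) ^ n) ^ 2) :
    Tendsto (fun n : ℕ => (hkColength F 4 ![4, 4, 4, 4] (p ^ n) : ℝ) / ((p : ℝ) ^ n) ^ 3)
      atTop (nhds (8 / 3 + 128 * ε)) := by
  have hp0 : (0 : ℝ) < p := by exact_mod_cast (by omega : 0 < p)
  rw [tendsto_iff_norm_sub_tendsto_zero]
  have hlim : Tendsto (fun n : ℕ => (128 * a + 40000) * ((p : ℝ)⁻¹) ^ n) atTop (nhds 0) := by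
    rw [← mul_zero (128 * a + 40000)]
    apply Tendsto.const_mul
    apply tendsto_pow_atTop_nhds_zero_of_lt_one (by positivity)
    apply inv_lt_one_of_one_lt₀
    exact_mod_cast (by omega : 1 < p)
  refine squeeze_zero (fun _ => norm_nonneg _) (fun n => ?_) hlim
  obtain ⟨k, ⟨h1, h2⟩, h3⟩ := h n
  have hb := hk_bound (F := F) k (p ^ n) a ε (Nat.one_le_pow _ _ (by omega)) h1 h2 ha (by push_cast; exact h3)
  push_cast at hb
  have hQ : (0 : ℝ) < (p : ℝ) ^ n := by positivity
  rw [Real.norm_eq_abs, inv_pow]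
  set Q := (p : ℝ) ^ n
  have e1 : (hkColength F 4 ![4, 4, 4, 4] (p ^ n) : ℝ) / Q ^ 3 - (8 / 3 + 128 * ε) =
    ((hkColength F 4 ![4, 4, 4, 4] (p ^ n) : ℝ) - (8 / 3 + 128 * ε) * Q ^ 3) / Q ^ 3 := by
    field_simp
  rw [e1, abs_div, abs_of_pos (pow_pos hQ 3), div_le_iff₀ (pow_pos hQ 3)]
  refine hb.trans (le_of_eq ?_)
  field_simp

end final
end HKaux

/-- Chang, Gessel–Monsky: for an odd prime `p`,
`R = (ℤ/pℤ)[w,x,y,z]/(w⁴+x⁴+y⁴+z⁴)` and `I = (w,x,y,z)`, the Hilbert–Kunz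
multiplicity `e_HK(I,R) = lim_n dim (R/I^{[pⁿ]})/p^{3n}` exists and equals
`(8/3)·(2p²+2p+3)/(2p²+2p+1)` when `p ≡ 1 (mod 4)` and
`(8/3)·(2p²−2p+3)/(2p²−2p+1)` when `p ≡ 3 (mod 4)`; in particular
`e_HK(I,R) = 8/3 + O(1/p²)`. -/
theorem statement15 :
    ∃ C > (0:ℝ), ∀ p : ℕ, p.Prime → Odd p →
      ∃ e : ℝ,
        Filter.Tendsto
          (fun n : ℕ =>
            (hkColength (ZMod p) 4 ![4, 4, 4, 4] (p ^ n) : ℝ) / ((p : ℝ) ^ n) ^ 3)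
          Filter.atTop (nhds e) ∧
        (p % 4 = 1 →
          e = (8 / 3) * (2 * (p : ℝ) ^ 2 + 2 * p + 3) / (2 * (p : ℝ) ^ 2 + 2 * p + 1)) ∧
        (p % 4 = 3 →
          e = (8 / 3) * (2 * (p : ℝ) ^ 2 - 2 * p + 3) / (2 * (p : ℝ) ^ 2 - 2 * p + 1)) ∧
        |e - 8 / 3| ≤ C / (p : ℝ) ^ 2 := by
  refine ⟨16 / 3, by norm_num, fun p hp hodd => ?_⟩
  have : Fact p.Prime := ⟨hp⟩
  have hp2 := hp.two_le
  have hp1 : (1 : ℝ) ≤ p := by exact_mod_cast hp.one_lt.le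
  have hm : p % 4 = 1 ∨ p % 4 = 3 := by
    have := Nat.odd_iff.1 hodd
    omega
  rcases hm with hm | hm
  · have hD : (0 : ℝ) < 2 * (p : ℝ) ^ 2 + 2 * p + 1 := by positivity
    refine ⟨8 / 3 + 128 * (1 / 24 / (2 * (p : ℝ) ^ 2 + 2 * p + 1)), ?_, ?_, ?_, ?_⟩
    · refine HKaux.hk_tendsto (F := ZMod p) p hp2 ((p / 4 : ℕ) : ℝ) _ (Nat.cast_nonneg _) fun n => ?_
      obtain ⟨k, h1, _, h3⟩ := HKaux.asym1 (F := ZMod p) (p := p) (p / 4) (by omega) n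
      exact ⟨k, h1, h3⟩
    · intro _
      field_simp
      ring
    · intro h; omega
    · have : (0 : ℝ) < 1 / 24 / (2 * (p : ℝ) ^ 2 + 2 * p + 1) := by positivity
      rw [add_sub_cancel_left, abs_of_pos (by positivity)]
      rw [show 128 * (1 / 24 / (2 * (p : ℝ) ^ 2 + 2 * p + 1)) = 16 / 3 / (2 * (p : ℝ) ^ 2 + 2 * p + 1) by ring]
      apply div_le_div_of_nonneg_left (by norm_num) (by positivity)
      nlinarith
  · have hD : (0 : ℝ) < 2 * (p : ℝ) ^ 2 - 2 * p + 1 := by nlinarith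
    refine ⟨8 / 3 + 128 * (1 / 24 / (2 * (p : ℝ) ^ 2 - 2 * p + 1)), ?_, ?_, ?_, ?_⟩
    · refine HKaux.hk_tendsto (F := ZMod p) p hp2 (((p + 1) / 4 : ℕ) : ℝ) _ (Nat.cast_nonneg _) fun n => ?_
      obtain ⟨k, h1, _, h3⟩ := HKaux.asym3 (F := ZMod p) (p := p) ((p + 1) / 4) (by omega) n
      exact ⟨k, h1, h3⟩
    · intro h; omega
    · intro _
      rw [eq_div_iff hD.ne', add_mul, mul_assoc, div_mul_cancel₀ _ hD.ne']
      ring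
    · have : (0 : ℝ) < 1 / 24 / (2 * (p : ℝ) ^ 2 - 2 * p + 1) := by positivity
      rw [add_sub_cancel_left, abs_of_pos (by positivity)]
      rw [show 128 * (1 / 24 / (2 * (p : ℝ) ^ 2 - 2 * p + 1)) = 16 / 3 / (2 * (p : ℝ) ^ 2 - 2 * p + 1) by ring]
      apply div_le_div_of_nonneg_left (by norm_num) (by positivity)
      nlinarith
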